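/- arXiv:math/0611829 — 4 statements merged into one kernel-verified Lean document; each statement's English description precedes it below -/
import Mathlib

section
/- Let d ≥ 1 and let Q ⊆ M_d(ℂ) be a nonempty compact subset. The following are equivalent: (i) the (not necessarily unital) subalgebra of M_d(ℂ) generated by Q is nilpotent (every product of n of its elements vanishes, for some n); (ii) Δ(Q) = 0, where Δ(Q) = inf_{g ∈ SL_d(ℂ)} max_{a ∈ Q} ‖g a g⁻¹‖; (iii) for every i with 1 ≤ i ≤ d², every element of Q^i has spectral radius 0 (i.e. every product of at most d² elements of Q is nilpotent). -/
open scoped Pointwise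

/-- The operator norm of a complex matrix, induced by the Hermitian norm on `ℂ^d`. -/
noncomputable def opNormC {d : ℕ} (A : Matrix (Fin d) (Fin d) ℂ) : ℝ :=
  ‖LinearMap.toContinuousLinearMap (Matrix.toEuclideanLin A)‖

/-- `Δ(Q) = inf_{g ∈ SL_d(ℂ)} max_{a ∈ Q} ‖g a g⁻¹‖`. -/
noncomputable def DeltaC {d : ℕ} (Q : Set (Matrix (Fin d) (Fin d) ℂ)) : ℝ :=
  ⨅ g : Matrix.SpecialLinearGroup (Fin d) ℂ,
    sSup ((fun a => opNormC ((g : Matrix (Fin d) (Fin d) ℂ) * a *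
      ((g⁻¹ : Matrix.SpecialLinearGroup (Fin d) ℂ) : Matrix (Fin d) (Fin d) ℂ))) '' Q)

section Algebraic

/-- An endomorphism, in characteristic zero, all of whose positive powers have trace zero is
nilpotent. -/
theorem Module.End.isNilpotent_of_forall_trace_pow_eq_zero {K V : Type*} [Field K] [CharZero K]
    [AddCommGroup V] [Module K V] [FiniteDimensional K V] {f : Module.End K V}
    (hf : ∀ n : ℕ, LinearMap.trace K V (f ^ (n + 1)) = 0) : IsNilpotent f := by
  open Polynomial in
  have hX (p : K[X]) : LinearMap.trace K V (aeval f (X * p)) = 0 := by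
    induction p using Polynomial.induction_on' with
    | add p q hp hq => rw [mul_add, map_add, map_add, hp, hq, add_zero]
    | monomial n a =>
      rw [← C_mul_X_pow_eq_monomial, mul_left_comm, ← pow_succ', map_mul, aeval_C,
        map_pow, aeval_X, Algebra.algebraMap_eq_smul_one, smul_mul_assoc, one_mul, map_smul, hf,
        smul_zero]
  have hne : (X : K[X]) * f.charpoly ≠ 0 := mul_ne_zero X_ne_zero f.charpoly_monic.ne_zero
  obtain ⟨n, g, hg, hXg⟩ : ∃ (n : ℕ) (g : K[X]), ¬ X ∣ g ∧ X * f.charpoly = X ^ n * g := by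
    obtain ⟨g, h1, h2⟩ := exists_eq_pow_rootMultiplicity_mul_and_not_dvd (X * f.charpoly) hne 0
    rw [C_0, sub_zero] at h1 h2
    exact ⟨_, g, h2, h1⟩
  have hn : n ≠ 0 := by
    rintro rfl
    rw [pow_zero, one_mul] at hXg
    exact hg ⟨_, hXg.symm⟩
  obtain ⟨u, v, huv⟩ : IsCoprime (X ^ n) g :=
    ((prime_X.irreducible.coprime_iff_not_dvd).2 hg).pow_left
  have hzero : aeval f (X ^ n * g) = 0 := by
    rw [← hXg, map_mul, LinearMap.aeval_self_charpoly, mul_zero]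
  have hidem : IsIdempotentElem (aeval f (X ^ n * u)) := by
    have : (X ^ n * u) * (X ^ n * u) = X ^ n * u - u * v * (X ^ n * g) := by
      linear_combination (X ^ n * u) * huv
    rw [IsIdempotentElem, ← map_mul, this, map_sub, map_mul _ (u * v), hzero, mul_zero, sub_zero]
  have he : aeval f (X ^ n * u) = 0 := by
    refine (LinearMap.IsIdempotentElem.trace_eq_zero_iff hidem).1 ?_
    obtain ⟨m, rfl⟩ := Nat.exists_eq_succ_of_ne_zero hn
    rw [pow_succ', mul_assoc]
    exact hX _
  refine ⟨n, ?_⟩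
  have : (X : K[X]) ^ n = X ^ n * (X ^ n * u) + v * (X ^ n * g) := by
    linear_combination (-X ^ n) * huv
  rw [← aeval_X (R := K) f, ← map_pow, this, map_add, map_mul, map_mul _ v, he, hzero]
  simp

attribute [local instance] LieRing.ofAssociativeRing in
/-- A finite-dimensional algebra of nilpotent endomorphisms is nilpotent. -/
theorem NonUnitalSubalgebra.exists_list_prod_eq_zero_of_isNilpotent {K V : Type*} [Field K]
    [AddCommGroup V] [Module K V] [FiniteDimensional K V]
    (A : NonUnitalSubalgebra K (Module.End K V)) (hA : ∀ a ∈ A, IsNilpotent a) :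
    ∃ n : ℕ, ∀ L : List (Module.End K V), (∀ x ∈ L, x ∈ A) → L.length = n → L.prod = 0 := by
  let A' : LieSubalgebra K (Module.End K V) :=
    { A.toSubmodule with
      lie_mem' := fun {x y} hx hy => A.sub_mem (A.mul_mem hx hy) (A.mul_mem hy hx) }
  have hnil : LieModule.IsNilpotent A' V :=
    (LieModule.isNilpotent_iff_forall (R := K)).2 fun x => hA x x.2
  obtain ⟨n, hn⟩ := (LieModule.isNilpotent_iff K A' V).1 hnil
  have key (v : V) (L : List (Module.End K V)) (hL : ∀ x ∈ L, x ∈ A) :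
      L.prod v ∈ LieModule.lowerCentralSeries K A' V L.length := by
    induction L with
    | nil => simp
    | cons a L ih =>
      rw [List.length_cons, LieModule.lowerCentralSeries_succ, List.prod_cons]
      have ha : a ∈ A' := hL a List.mem_cons_self
      exact LieSubmodule.lie_mem_lie (LieSubmodule.mem_top (⟨a, ha⟩ : A'))
        (ih fun x hx => hL x (List.mem_cons_of_mem _ hx))
  refine ⟨n, fun L hL hlen => LinearMap.ext fun v => ?_⟩
  have := key v L hL
  rw [hlen, hn] at this
  exact this

/-- The algebra generated by a set is spanned by the products of length at most its dimension. -/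
theorem NonUnitalAlgebra.exists_adjoin_le_span_pow {K R : Type*} [Field K] [Ring R] [Algebra K R]
    [FiniteDimensional K R] (Q : Set R) :
    ((NonUnitalAlgebra.adjoin K Q).toSubmodule : Submodule K R) ≤
      Submodule.span K {a | ∃ i, 1 ≤ i ∧ i ≤ Module.finrank K R ∧ a ∈ Q ^ i} := by
  set W : ℕ → Submodule K R := fun k => Submodule.span K {a | ∃ i, 1 ≤ i ∧ i ≤ k ∧ a ∈ Q ^ i}
    with hW
  have hmono : Monotone W := fun k l hkl =>
    Submodule.span_mono fun a ⟨i, h1, h2, h3⟩ => ⟨i, h1, h2.trans hkl, h3⟩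
  obtain ⟨k, hk, hWk⟩ : ∃ k ≤ Module.finrank K R, W k = W (k + 1) := by
    by_contra! h
    have hdim : ∀ k ≤ Module.finrank K R + 1, k ≤ Module.finrank K (W k) := by
      intro k
      induction k with
      | zero => simp
      | succ k ih =>
        intro hk
        have hlt : W k < W (k + 1) := (hmono k.le_succ).lt_of_ne (h k (by omega))
        have := Submodule.finrank_lt_finrank_of_lt hlt
        have := ih (by omega)
        omega
    have := hdim _ le_rfl
    have := Submodule.finrank_le (W (Module.finrank K R + 1))
    omega
  have hmem {q : R} (hq : q ∈ Q) : q ∈ W k := by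
    rw [hWk]
    exact Submodule.subset_span ⟨1, le_rfl, by omega, by simpa using hq⟩
  have hmul {q w : R} (hq : q ∈ Q) (hw : w ∈ W k) : w * q ∈ W k := by
    induction hw using Submodule.span_induction with
    | mem x hx =>
      obtain ⟨i, h1, h2, h3⟩ := hx
      rw [hWk]
      exact Submodule.subset_span
        ⟨i + 1, by omega, by omega, by rw [pow_succ]; exact Set.mul_mem_mul h3 hq⟩
    | zero => simp
    | add x y _ _ hx hy => rw [add_mul]; exact add_mem hx hy
    | smul c x _ hx => rw [smul_mul_assoc]; exact Submodule.smul_mem _ _ hx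
  intro x hx
  refine hmono hk ?_
  suffices x ∈ W k ∧ ∀ w ∈ W k, w * x ∈ W k from this.1
  induction hx using NonUnitalAlgebra.adjoin_induction with
  | mem x hx => exact ⟨hmem hx, fun w hw => hmul hx hw⟩
  | zero => simp
  | add x y _ _ hx hy =>
    exact ⟨add_mem hx.1 hy.1, fun w hw => by rw [mul_add]; exact add_mem (hx.2 w hw) (hy.2 w hw)⟩
  | mul x y _ _ hx hy =>
    exact ⟨hy.2 x hx.1, fun w hw => by rw [← mul_assoc]; exact hy.2 _ (hx.2 w hw)⟩
  | smul c x _ hx =>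
    exact ⟨Submodule.smul_mem _ _ hx.1, fun w hw => by
      rw [mul_smul_comm]; exact Submodule.smul_mem _ _ (hx.2 w hw)⟩

theorem Matrix.trace_eq_zero_of_spectralRadius_eq_zero {ι : Type*} [Fintype ι] [DecidableEq ι]
    {a : Matrix ι ι ℂ} (ha : spectralRadius ℂ a = 0) : a.trace = 0 := by
  rw [Matrix.trace_eq_sum_roots_charpoly]
  refine Multiset.sum_eq_zero fun z hz => ?_
  have hz' : z ∈ spectrum ℂ a :=
    Matrix.mem_spectrum_iff_isRoot_charpoly.2 (Polynomial.isRoot_of_mem_roots hz)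
  have : (‖z‖₊ : ENNReal) ≤ spectralRadius ℂ a :=
    le_iSup₂ (f := fun k (_ : k ∈ spectrum ℂ a) => (‖k‖₊ : ENNReal)) z hz'
  rw [ha] at this
  simpa using this

theorem Matrix.exists_list_prod_eq_zero_of_spectralRadius_eq_zero {d : ℕ}
    {Q : Set (Matrix (Fin d) (Fin d) ℂ)}
    (hQ : ∀ i : ℕ, 1 ≤ i → i ≤ d ^ 2 → ∀ a ∈ Q ^ i, spectralRadius ℂ a = 0) :
    ∃ n : ℕ, ∀ L : List (Matrix (Fin d) (Fin d) ℂ),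
      (∀ x ∈ L, x ∈ NonUnitalAlgebra.adjoin ℂ Q) → L.length = n → L.prod = 0 := by
  have htr {a} (ha : a ∈ NonUnitalAlgebra.adjoin ℂ Q) : a.trace = 0 := by
    have hspan := NonUnitalAlgebra.exists_adjoin_le_span_pow (K := ℂ) Q ha
    refine (Submodule.span_le (p := LinearMap.ker (Matrix.traceLinearMap (Fin d) ℂ ℂ))).2 ?_ hspan
    rintro b ⟨i, h1, h2, hb⟩
    refine Matrix.trace_eq_zero_of_spectralRadius_eq_zero (hQ i h1 ?_ b hb)
    simpa [Module.finrank_matrix, sq] using h2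
  let φ : Matrix (Fin d) (Fin d) ℂ ≃ₐ[ℂ] Module.End ℂ (Fin d → ℂ) := Matrix.toLinAlgEquiv'
  have hpow {a} (ha : a ∈ NonUnitalAlgebra.adjoin ℂ Q) (n : ℕ) :
      a ^ (n + 1) ∈ NonUnitalAlgebra.adjoin ℂ Q := by
    induction n with
    | zero => simpa using ha
    | succ n ih => rw [pow_succ]; exact mul_mem ih ha
  obtain ⟨n, hn⟩ := NonUnitalSubalgebra.exists_list_prod_eq_zero_of_isNilpotent
    ((NonUnitalAlgebra.adjoin ℂ Q).map
      (φ : Matrix (Fin d) (Fin d) ℂ →ₐ[ℂ] Module.End ℂ (Fin d → ℂ))) (by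
      rintro _ ⟨a, ha, rfl⟩
      refine Module.End.isNilpotent_of_forall_trace_pow_eq_zero fun n => ?_
      have : φ a ^ (n + 1) = Matrix.toLin' (a ^ (n + 1)) := (map_pow φ a (n + 1)).symm
      change LinearMap.trace _ _ (φ a ^ (n + 1)) = 0
      rw [this, Matrix.trace_toLin'_eq]
      exact htr (hpow ha n))
  refine ⟨n, fun L hL hlen => φ.injective ?_⟩
  rw [map_zero, map_list_prod]
  refine hn _ ?_ (by simpa using hlen)
  intro x hx
  obtain ⟨y, hy, rfl⟩ := List.mem_map.1 hx
  exact ⟨y, hL y hy, rfl⟩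

end Algebraic

section Analytic

open scoped Matrix.Norms.L2Operator MatrixOrder ComplexOrder
open Matrix

theorem opNormC_eq_norm {d : ℕ} (A : Matrix (Fin d) (Fin d) ℂ) : opNormC A = ‖A‖ := rfl

variable {d : ℕ}

/-- The set of operator norms over which the supremum in `DeltaC` is taken is bounded. -/
theorem bddAbove_opNormC_conj {Q : Set (Matrix (Fin d) (Fin d) ℂ)} (hQ : IsCompact Q)
    (g h : Matrix (Fin d) (Fin d) ℂ) : BddAbove ((fun a => opNormC (g * a * h)) '' Q) := by
  refine (hQ.image ?_).bddAbove
  simp only [opNormC_eq_norm]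
  fun_prop

theorem DeltaC_nonneg (Q : Set (Matrix (Fin d) (Fin d) ℂ)) : 0 ≤ DeltaC Q :=
  Real.iInf_nonneg fun _ => Real.sSup_nonneg (by rintro _ ⟨a, -, rfl⟩; exact norm_nonneg _)

theorem norm_conj_le_pow {Q : Set (Matrix (Fin d) (Fin d) ℂ)} {g h : Matrix (Fin d) (Fin d) ℂ}
    (hgh : h * g = 1) {ε : ℝ} (hQ : ∀ a ∈ Q, ‖g * a * h‖ ≤ ε) (i : ℕ) :
    ∀ a ∈ Q ^ (i + 1), ‖g * a * h‖ ≤ ε ^ (i + 1) := by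
  induction i with
  | zero => simpa using hQ
  | succ i ih =>
    intro a ha
    rw [pow_succ] at ha
    obtain ⟨b, hb, c, hc, rfl⟩ := Set.mem_mul.1 ha
    have : g * (b * c) * h = (g * b * h) * (g * c * h) := by
      calc g * (b * c) * h = g * b * 1 * c * h := by simp only [mul_one, mul_assoc]
        _ = _ := by rw [← hgh]; simp only [mul_assoc]
    rw [this, pow_succ]
    exact (norm_mul_le _ _).trans
      (mul_le_mul (ih b hb) (hQ c hc) (norm_nonneg _) ((norm_nonneg _).trans (ih b hb)))

theorem spectralRadius_eq_zero_of_DeltaC_eq_zero (hd : 1 ≤ d)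
    {Q : Set (Matrix (Fin d) (Fin d) ℂ)} (hQ : IsCompact Q) (hΔ : DeltaC Q = 0) {i : ℕ}
    (hi : 1 ≤ i) {a : Matrix (Fin d) (Fin d) ℂ} (ha : a ∈ Q ^ i) : spectralRadius ℂ a = 0 := by
  have : NeZero d := ⟨by omega⟩
  obtain ⟨i, rfl⟩ := Nat.exists_eq_succ_of_ne_zero (Nat.one_le_iff_ne_zero.1 hi)
  refine le_antisymm (ENNReal.le_of_forall_pos_le_add fun δ hδ _ => ?_) bot_le
  rw [zero_add]
  set ε : ℝ := min δ 1
  have hε : 0 < ε := lt_min hδ one_pos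
  obtain ⟨g, hg⟩ := exists_lt_of_ciInf_lt (hΔ.trans_lt hε)
  have hgu : ((g⁻¹ : Matrix.SpecialLinearGroup (Fin d) ℂ) : Matrix (Fin d) (Fin d) ℂ) *
      (g : Matrix (Fin d) (Fin d) ℂ) = 1 := by
    rw [← Matrix.SpecialLinearGroup.coe_mul, inv_mul_cancel, Matrix.SpecialLinearGroup.coe_one]
  have hug : (g : Matrix (Fin d) (Fin d) ℂ) *
      ((g⁻¹ : Matrix.SpecialLinearGroup (Fin d) ℂ) : Matrix (Fin d) (Fin d) ℂ) = 1 := by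
    rw [← Matrix.SpecialLinearGroup.coe_mul, mul_inv_cancel, Matrix.SpecialLinearGroup.coe_one]
  have hbound := norm_conj_le_pow hgu (Q := Q) (ε := ε) (fun b hb =>
    (le_csSup (bddAbove_opNormC_conj hQ _ _) (Set.mem_image_of_mem _ hb)).trans hg.le) i a ha
  have hspec := spectrum.units_conjugate (R := ℂ) (a := a)
    (u := (⟨_, _, hug, hgu⟩ : (Matrix (Fin d) (Fin d) ℂ)ˣ))
  calc spectralRadius ℂ a
      = spectralRadius ℂ ((g : Matrix (Fin d) (Fin d) ℂ) * a *
        ((g⁻¹ : Matrix.SpecialLinearGroup (Fin d) ℂ) : Matrix (Fin d) (Fin d) ℂ)) := by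
        unfold spectralRadius
        rw [← hspec]
        rfl
    _ ≤ _ := spectrum.spectralRadius_le_nnnorm _
    _ ≤ δ := by
      rw [ENNReal.coe_le_coe, ← NNReal.coe_le_coe, coe_nnnorm]
      refine hbound.trans ((pow_le_of_le_one hε.le (min_le_right _ _) i.succ_ne_zero).trans
        (min_le_left _ _))

/-- The sum `∑ j, (b j)ᴴ * X * b j`. -/
noncomputable def conjSum {ι n : Type*} [Fintype ι] [Fintype n] (b : ι → Matrix n n ℂ)
    (X : Matrix n n ℂ) : Matrix n n ℂ :=
  ∑ j, (b j)ᴴ * X * b j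

theorem conjSum_posSemidef {ι n : Type*} [Fintype ι] [Fintype n] (b : ι → Matrix n n ℂ)
    {X : Matrix n n ℂ} (hX : X.PosSemidef) : (conjSum b X).PosSemidef :=
  Matrix.posSemidef_sum _ fun j _ => hX.conjTranspose_mul_mul_same (b j)

theorem conjTranspose_mul_iterate_conjSum_mul_eq_zero {ι n : Type*} [Fintype ι] [Fintype n]
    [DecidableEq n] (b : ι → Matrix n n ℂ) (X : Matrix n n ℂ) (k : ℕ) (y : Matrix n n ℂ)
    (hy : ∀ L : List (Matrix n n ℂ), (∀ x ∈ L, x ∈ Set.range b) → L.length = k →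
      L.prod * y = 0) : yᴴ * (conjSum b)^[k] X * y = 0 := by
  induction k generalizing y with
  | zero =>
    have : y = 0 := by simpa using hy [] (by simp) rfl
    simp [this]
  | succ k ih =>
    rw [Function.iterate_succ_apply', conjSum, Finset.mul_sum, Finset.sum_mul]
    refine Finset.sum_eq_zero fun j _ => ?_
    have := ih (b j * y) fun L hL hlen => by
      have := hy (L ++ [b j]) (by
        intro x hx
        rcases List.mem_append.1 hx with hx | hx
        · exact hL x hx
        · exact ⟨j, (List.mem_singleton.1 hx).symm⟩) (by simp [hlen])
      simpa [mul_assoc] using this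
    simpa [Matrix.conjTranspose_mul, mul_assoc] using this

/-- If all products of length `k` of the matrices `b j` vanish, the `b j` are simultaneously
similar to matrices of arbitrarily small norm. -/
theorem exists_isUnit_norm_conj_le {ι n : Type*} [Fintype ι] [Fintype n] [DecidableEq n]
    (b : ι → Matrix n n ℂ) (k : ℕ)
    (hb : ∀ L : List (Matrix n n ℂ), (∀ x ∈ L, x ∈ Set.range b) → L.length = k → L.prod = 0)
    {ε : ℝ} (hε : 0 < ε) :
    ∃ S : Matrix n n ℂ, IsUnit S ∧ ∀ j, ‖S * b j * S⁻¹‖ ≤ ε := by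
  have hnil : (conjSum b)^[k] 1 = 0 := by
    simpa using conjTranspose_mul_iterate_conjSum_mul_eq_zero b 1 k 1
      fun L h1 h2 => by rw [hb L h1 h2, zero_mul]
  set F : ℕ → Matrix n n ℂ := fun m => (conjSum b)^[m] 1 with hF
  have hFpos (m : ℕ) : (F m).PosSemidef := by
    induction m with
    | zero => exact Matrix.PosSemidef.one
    | succ m ih => simpa only [hF, Function.iterate_succ_apply'] using conjSum_posSemidef b ih
  set s : ℝ := (ε ^ 2)⁻¹ with hs
  have hs0 : 0 < s := by positivity
  set R : Matrix n n ℂ := ∑ m ∈ Finset.range k, s ^ (m + 1) • F (m + 1) with hR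
  have hRpos : R.PosSemidef := Matrix.posSemidef_sum _ fun m _ =>
    (hFpos _).smul (by positivity)
  have hPpos : (1 + R).PosDef := Matrix.PosDef.one.add_posSemidef hRpos
  have hP : 1 + R = ∑ m ∈ Finset.range k, s ^ m • F m := by
    have h1 := Finset.sum_range_succ' (fun m => s ^ m • F m) k
    have h2 := Finset.sum_range_succ (fun m => s ^ m • F m) k
    have h3 : F k = 0 := hnil
    have h4 : F 0 = 1 := rfl
    rw [h3, smul_zero, add_zero, h1, h4, pow_zero, one_smul, add_comm] at h2
    exact h2
  have hconj : s • conjSum b (1 + R) = R := by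
    rw [hP, hR]
    simp only [conjSum, hF, Function.iterate_succ_apply', Finset.mul_sum, Finset.sum_mul,
      Finset.smul_sum, mul_smul_comm, smul_mul_assoc, smul_smul, ← pow_succ']
    exact Finset.sum_comm
  obtain ⟨S, hSu, hSP⟩ := CStarAlgebra.isStrictlyPositive_iff_eq_star_mul_self.mp
    hPpos.isStrictlyPositive
  refine ⟨S, hSu, fun j => ?_⟩
  have hSS : S * S⁻¹ = 1 := Matrix.mul_nonsing_inv _ ((Matrix.isUnit_iff_isUnit_det _).1 hSu)
  set T := S * b j * S⁻¹ with hT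
  have hle : s • ((b j)ᴴ * (1 + R) * b j) ≤ 1 + R := by
    calc s • ((b j)ᴴ * (1 + R) * b j) ≤ s • conjSum b (1 + R) := by
          refine smul_le_smul_of_nonneg_left ?_ hs0.le
          exact Finset.single_le_sum (f := fun j => (b j)ᴴ * (1 + R) * b j) (fun i _ =>
            (hPpos.posSemidef.conjTranspose_mul_mul_same (b i)).nonneg) (Finset.mem_univ j)
      _ = R := hconj
      _ ≤ 1 + R := le_add_of_nonneg_left zero_le_one
  have hTT : s • (star T * T) ≤ 1 := by
    have h := star_left_conjugate_le_conjugate hle S⁻¹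
    have e1 : star S⁻¹ * (1 + R) * S⁻¹ = 1 := by
      rw [hSP, mul_assoc, mul_assoc, hSS, mul_one, ← star_mul, hSS, star_one]
    have e2 : star S⁻¹ * (s • ((b j)ᴴ * (1 + R) * b j)) * S⁻¹ = s • (star T * T) := by
      rw [hSP, hT, mul_smul_comm, smul_mul_assoc, ← star_eq_conjTranspose]
      simp only [star_mul, mul_assoc]
    rwa [e1, e2] at h
  have hnorm : s * ‖T‖ ^ 2 ≤ 1 := by
    have := (CStarAlgebra.norm_le_one_iff_of_nonneg (s • (star T * T))
      (smul_nonneg hs0.le (star_mul_self_nonneg T))).2 hTT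
    rwa [norm_smul, CStarRing.norm_star_mul_self, Real.norm_of_nonneg hs0.le, ← sq] at this
  have : ‖T‖ ^ 2 ≤ ε ^ 2 := by
    rw [hs] at hnorm
    rwa [inv_mul_le_iff₀ (by positivity), mul_one] at hnorm
  exact le_of_sq_le_sq this hε.le

theorem exists_specialLinearGroup_conj_eq (hd : 1 ≤ d) {S : Matrix (Fin d) (Fin d) ℂ}
    (hS : IsUnit S) : ∃ g : Matrix.SpecialLinearGroup (Fin d) ℂ,
      ∀ a, (g : Matrix (Fin d) (Fin d) ℂ) * a *
        ((g⁻¹ : Matrix.SpecialLinearGroup (Fin d) ℂ) : Matrix (Fin d) (Fin d) ℂ) =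
        S * a * S⁻¹ := by
  have hdet : S.det ≠ 0 := ((Matrix.isUnit_iff_isUnit_det _).1 hS).ne_zero
  obtain ⟨c, hc⟩ := IsAlgClosed.exists_pow_nat_eq S.det (n := d) (by omega)
  have hc0 : c ≠ 0 := by
    rintro rfl
    exact hdet (by rw [← hc, zero_pow (by omega)])
  let g : Matrix.SpecialLinearGroup (Fin d) ℂ := ⟨c⁻¹ • S, by
    rw [Matrix.det_smul, Fintype.card_fin, ← hc, ← mul_pow, inv_mul_cancel₀ hc0, one_pow]⟩
  refine ⟨g, fun a => ?_⟩
  have hg : (g : Matrix (Fin d) (Fin d) ℂ) = c⁻¹ • S := rfl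
  have hinv : S⁻¹ = c⁻¹ •
      ((g⁻¹ : Matrix.SpecialLinearGroup (Fin d) ℂ) : Matrix (Fin d) (Fin d) ℂ) := by
    refine Matrix.inv_eq_right_inv ?_
    rw [mul_smul_comm, ← smul_mul_assoc, ← hg, ← Matrix.SpecialLinearGroup.coe_mul,
      mul_inv_cancel, Matrix.SpecialLinearGroup.coe_one]
  rw [hinv, hg, smul_mul_assoc, smul_mul_assoc, mul_smul_comm]

/-- A compact subset of a subspace of matrices has uniformly bounded coordinates with respect to
some finite family of the subspace. -/
theorem exists_fin_family_bounded_coeff {Q : Set (Matrix (Fin d) (Fin d) ℂ)} (hQ : IsCompact Q)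
    (A : Submodule ℂ (Matrix (Fin d) (Fin d) ℂ)) (hQA : Q ⊆ A) :
    ∃ (m : ℕ) (b : Fin m → Matrix (Fin d) (Fin d) ℂ) (C : ℝ), (∀ j, b j ∈ A) ∧
      ∀ a ∈ Q, ∃ c : Fin m → ℂ, a = ∑ j, c j • b j ∧ ∑ j, ‖c j‖ ≤ C := by
  let β := Module.finBasis ℂ A
  choose f hf using fun j => LinearMap.exists_extend (β.coord j)
  have hcont : Continuous fun a => ∑ j, ‖f j a‖ :=
    continuous_finsetSum _ fun j _ => (LinearMap.continuous_of_finiteDimensional (f j)).norm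
  obtain ⟨C, hC⟩ := (hQ.image hcont).bddAbove
  refine ⟨_, fun j => β j, C, fun j => (β j).2, fun a ha =>
    ⟨fun j => f j a, ?_, hC ⟨a, ha, rfl⟩⟩⟩
  have h1 := congrArg A.subtype (β.sum_repr ⟨a, hQA ha⟩)
  rw [map_sum] at h1
  have h2 (j) : f j a = β.repr ⟨a, hQA ha⟩ j := LinearMap.congr_fun (hf j) ⟨a, hQA ha⟩
  simp only [h2]
  exact h1.symm

theorem DeltaC_eq_zero_of_adjoin_nilpotent (hd : 1 ≤ d) {Q : Set (Matrix (Fin d) (Fin d) ℂ)}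
    (hQne : Q.Nonempty) (hQ : IsCompact Q) {n : ℕ}
    (hn : ∀ L : List (Matrix (Fin d) (Fin d) ℂ),
        (∀ x ∈ L, x ∈ NonUnitalAlgebra.adjoin ℂ Q) → L.length = n → L.prod = 0) :
    DeltaC Q = 0 := by
  refine le_antisymm (le_of_forall_pos_le_add fun δ hδ => ?_) (DeltaC_nonneg Q)
  obtain ⟨m, b, C, hbA, hC⟩ := exists_fin_family_bounded_coeff hQ
    (NonUnitalAlgebra.adjoin ℂ Q).toSubmodule (NonUnitalAlgebra.subset_adjoin ℂ)
  have hC0 : 0 ≤ C := by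
    obtain ⟨a, ha⟩ := hQne
    obtain ⟨c, -, hc⟩ := hC a ha
    exact (Finset.sum_nonneg fun j _ => norm_nonneg (c j)).trans hc
  obtain ⟨S, hS, hSb⟩ := exists_isUnit_norm_conj_le b n (fun L hL hlen => hn L (fun x hx => by
    obtain ⟨j, rfl⟩ := hL x hx
    exact hbA j) hlen) (ε := δ / (C + 1)) (by positivity)
  obtain ⟨g, hg⟩ := exists_specialLinearGroup_conj_eq hd hS
  refine (ciInf_le ⟨0, ?_⟩ g).trans (csSup_le (hQne.image _) ?_)
  · rintro _ ⟨g, rfl⟩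
    exact Real.sSup_nonneg (by rintro _ ⟨a, -, rfl⟩; exact norm_nonneg _)
  rintro _ ⟨a, ha, rfl⟩
  obtain ⟨c, hac, hc⟩ := hC a ha
  simp only [hg, opNormC_eq_norm]
  calc ‖S * a * S⁻¹‖ = ‖∑ j, c j • (S * b j * S⁻¹)‖ := by
        rw [hac, Finset.mul_sum, Finset.sum_mul]
        simp only [mul_smul_comm, smul_mul_assoc]
    _ ≤ ∑ j, ‖c j‖ * (δ / (C + 1)) := norm_sum_le_of_le _ fun j _ => by
        rw [norm_smul]
        exact mul_le_mul_of_nonneg_left (hSb j) (norm_nonneg _)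
    _ ≤ C * (δ / (C + 1)) := by
        rw [← Finset.sum_mul]
        exact mul_le_mul_of_nonneg_right hc (by positivity)
    _ ≤ 0 + δ := by
        rw [zero_add, mul_div_assoc', div_le_iff₀ (by positivity)]
        nlinarith

end Analytic

theorem stmt10 {d : ℕ} (hd : 1 ≤ d)
    (Q : Set (Matrix (Fin d) (Fin d) ℂ)) (hQne : Q.Nonempty) (hQc : IsCompact Q) :
    ((∃ n : ℕ, 1 ≤ n ∧ ∀ L : List (Matrix (Fin d) (Fin d) ℂ),
        (∀ x ∈ L, x ∈ NonUnitalAlgebra.adjoin ℂ Q) → L.length = n → L.prod = 0)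
      ↔ DeltaC Q = 0) ∧
    (DeltaC Q = 0 ↔
      ∀ i : ℕ, 1 ≤ i → i ≤ d ^ 2 → ∀ a ∈ Q ^ i, spectralRadius ℂ a = 0) := by
  have h₁₂ : (∃ n : ℕ, 1 ≤ n ∧ ∀ L : List (Matrix (Fin d) (Fin d) ℂ),
      (∀ x ∈ L, x ∈ NonUnitalAlgebra.adjoin ℂ Q) → L.length = n → L.prod = 0) →
      DeltaC Q = 0 := fun ⟨_, _, hn⟩ => DeltaC_eq_zero_of_adjoin_nilpotent hd hQne hQc hn
  have h₂₃ : DeltaC Q = 0 → ∀ i : ℕ, 1 ≤ i → i ≤ d ^ 2 → ∀ a ∈ Q ^ i, spectralRadius ℂ a = 0 :=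
    fun hΔ i hi _ a ha => spectralRadius_eq_zero_of_DeltaC_eq_zero hd hQc hΔ hi ha
  have h₃₁ : (∀ i : ℕ, 1 ≤ i → i ≤ d ^ 2 → ∀ a ∈ Q ^ i, spectralRadius ℂ a = 0) →
      ∃ n : ℕ, 1 ≤ n ∧ ∀ L : List (Matrix (Fin d) (Fin d) ℂ),
        (∀ x ∈ L, x ∈ NonUnitalAlgebra.adjoin ℂ Q) → L.length = n → L.prod = 0 := by
    intro h
    obtain ⟨n, hn⟩ := Matrix.exists_list_prod_eq_zero_of_spectralRadius_eq_zero h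
    refine ⟨n + 1, by omega, fun L hL hlen => ?_⟩
    match L with
    | [] => simp at hlen
    | a :: L =>
      rw [List.prod_cons, hn L (fun x hx => hL x (List.mem_cons_of_mem _ hx)) (by simpa using hlen),
        mul_zero]
  exact ⟨⟨h₁₂, h₃₁ ∘ h₂₃⟩, h₂₃, h₁₂ ∘ h₃₁⟩
end

section
/- Let d ≥ 2. There exist positive constants C₁ and C₂ (depending only on d) such that for every finite subset Σ ⊆ SL_d(ℤ) generating a subgroup that is Zariski dense in SL_d, and for every g ∈ SL_d(ℝ), one has max_{σ ∈ Σ} ‖g σ g⁻¹‖ ≥ C₂ · (inf_{γ ∈ SL_d(ℤ)} ‖g γ‖)^{C₁}. -/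
/-- The operator norm of a real matrix, induced by the Euclidean norm on `ℝ^d`. -/
noncomputable def opNormR {d : ℕ} (A : Matrix (Fin d) (Fin d) ℝ) : ℝ :=
  ‖LinearMap.toContinuousLinearMap (Matrix.toEuclideanLin A)‖

/-- The real matrix associated to an element of `SL_d(ℤ)`. -/
def intMat {d : ℕ} (γ : Matrix.SpecialLinearGroup (Fin d) ℤ) : Matrix (Fin d) (Fin d) ℝ :=
  (γ : Matrix (Fin d) (Fin d) ℤ).map ((↑) : ℤ → ℝ)

/-- A subgroup of `SL_d(ℤ)` is Zariski dense in `SL_d` if every polynomial with rational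
coefficients in the matrix entries vanishing on the subgroup vanishes on all of `SL_d(ℂ)`. -/
def ZariskiDenseSLZ (d : ℕ) (Δ : Subgroup (Matrix.SpecialLinearGroup (Fin d) ℤ)) : Prop :=
  ∀ p : MvPolynomial (Fin d × Fin d) ℚ,
    (∀ γ ∈ Δ, MvPolynomial.aeval
        (fun ij : Fin d × Fin d =>
          (((γ : Matrix (Fin d) (Fin d) ℤ) ij.1 ij.2 : ℤ) : ℚ)) p = 0) →
    ∀ g : Matrix.SpecialLinearGroup (Fin d) ℂ,
      MvPolynomial.aeval
        (fun ij : Fin d × Fin d => (g : Matrix (Fin d) (Fin d) ℂ) ij.1 ij.2) p = 0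

open Matrix in
/-- The vector `g n` for an integer vector `n`. -/
noncomputable def latticeVec {d : ℕ} (g : Matrix (Fin d) (Fin d) ℝ) (n : Fin d → ℤ) : Fin d → ℝ :=
  g *ᵥ fun j => (n j : ℝ)

open Matrix in
/-- For nonzero `u` and `w`, some element of `SL_d(ℂ)` satisfies `u ⬝ g w ≠ 0`. -/
theorem exists_specialLinear_dotProduct_ne_zero {d : ℕ} {u w : Fin d → ℂ} (hu : u ≠ 0)
    (hw : w ≠ 0) :
    ∃ g : SpecialLinearGroup (Fin d) ℂ, u ⬝ᵥ ((g : Matrix (Fin d) (Fin d) ℂ) *ᵥ w) ≠ 0 := by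
  by_cases h : u ⬝ᵥ w = 0
  · obtain ⟨i, hi⟩ := Function.ne_iff.1 hu
    obtain ⟨j, hj⟩ := Function.ne_iff.1 hw
    have key : ∃ i j, i ≠ j ∧ u i * w j ≠ 0 := by
      by_contra! hc
      have hij : i = j := by
        by_contra hne
        exact mul_ne_zero hi hj (hc i j hne)
      subst hij
      have : u ⬝ᵥ w = u i * w i := by
        refine Finset.sum_eq_single i (fun b _ hb => ?_) (by simp)
        have h1 := hc b i hb
        rcases mul_eq_zero.1 h1 with h2 | h2
        · simp [h2]
        · exact absurd h2 hj
      exact mul_ne_zero hi hj (this ▸ h)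
    obtain ⟨i, j, hij, hne⟩ := key
    refine ⟨⟨transvection i j 1, det_transvection_of_ne i j hij 1⟩, ?_⟩
    have h1 : (transvection i j (1 : ℂ)) *ᵥ w = w + Pi.single i (w j) := by
      ext k
      simp [transvection, add_mulVec, Matrix.single_mulVec, Function.update_apply,
        Pi.single_apply]
    change u ⬝ᵥ (transvection i j (1 : ℂ) *ᵥ w) ≠ 0
    rwa [h1, dotProduct_add, h, zero_add, dotProduct_single]
  · exact ⟨1, by simpa using h⟩

/-- The rational linear map associated to an element of `SL_d(ℤ)`. -/
def ratAction {d : ℕ} (γ : Matrix.SpecialLinearGroup (Fin d) ℤ) :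
    (Fin d → ℚ) →ₗ[ℚ] (Fin d → ℚ) :=
  Matrix.toLin' ((γ : Matrix (Fin d) (Fin d) ℤ).map ((↑) : ℤ → ℚ))

theorem ratAction_mul {d : ℕ} (γ δ : Matrix.SpecialLinearGroup (Fin d) ℤ) :
    ratAction (γ * δ) = ratAction γ ∘ₗ ratAction δ := by
  have : ((γ * δ : Matrix.SpecialLinearGroup (Fin d) ℤ) : Matrix (Fin d) (Fin d) ℤ).map
      ((↑) : ℤ → ℚ) = (γ : Matrix (Fin d) (Fin d) ℤ).map ((↑) : ℤ → ℚ) *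
        (δ : Matrix (Fin d) (Fin d) ℤ).map ((↑) : ℤ → ℚ) :=
    Matrix.map_mul (f := Int.castRingHom ℚ)
  rw [ratAction, this, Matrix.toLin'_mul]
  rfl

theorem ratAction_one {d : ℕ} :
    ratAction (1 : Matrix.SpecialLinearGroup (Fin d) ℤ) = LinearMap.id := by
  simp [ratAction]

theorem ratAction_intCast {d : ℕ} (γ : Matrix.SpecialLinearGroup (Fin d) ℤ) (x : Fin d → ℤ) :
    ratAction γ (fun j => (x j : ℚ)) =
      fun j => (((γ : Matrix (Fin d) (Fin d) ℤ).mulVec x) j : ℚ) := by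
  ext j
  simp [ratAction, Matrix.mulVec, dotProduct]

/-- A subspace of `ℚ^d` invariant under a set is invariant under the subgroup it generates. -/
theorem ratAction_mem_of_mem_closure {d : ℕ}
    {S : Set (Matrix.SpecialLinearGroup (Fin d) ℤ)} {W : Submodule ℚ (Fin d → ℚ)}
    (hS : ∀ σ ∈ S, ∀ w ∈ W, ratAction σ w ∈ W) {γ : Matrix.SpecialLinearGroup (Fin d) ℤ}
    (hγ : γ ∈ Subgroup.closure S) : ∀ w ∈ W, ratAction γ w ∈ W := by
  induction hγ using Subgroup.closure_induction with
  | mem σ hσ => exact hS σ hσ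
  | one => simp [ratAction_one]
  | mul a b _ _ ha hb =>
    intro w hw
    rw [ratAction_mul]
    exact ha _ (hb _ hw)
  | inv a _ ha =>
    have hinv : ∀ x, ratAction a⁻¹ (ratAction a x) = x := fun x => by
      rw [← LinearMap.comp_apply, ← ratAction_mul, inv_mul_cancel, ratAction_one,
        LinearMap.id_apply]
    have hinj : Function.Injective (ratAction a) := Function.LeftInverse.injective hinv
    have hmap : W.map (ratAction a) = W :=
      Submodule.eq_of_le_of_finrank_eq (Submodule.map_le_iff_le_comap.2 ha)
        (Submodule.equivMapOfInjective _ hinj W).finrank_eq.symm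
    intro w hw
    rw [← hmap] at hw
    obtain ⟨y, hy, rfl⟩ := hw
    rwa [hinv]

open Matrix in
/-- A Zariski dense subgroup of `SL_d(ℤ)` acts irreducibly on `ℚ^d`. -/
theorem ZariskiDenseSLZ.exists_ratAction_notMem {d : ℕ}
    {S : Set (SpecialLinearGroup (Fin d) ℤ)} (hS : ZariskiDenseSLZ d (Subgroup.closure S))
    {W : Submodule ℚ (Fin d → ℚ)} (hbot : W ≠ ⊥) (htop : W ≠ ⊤) :
    ∃ σ ∈ S, ∃ w ∈ W, ratAction σ w ∉ W := by
  by_contra! hinv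
  obtain ⟨w, hwW, hw⟩ := W.ne_bot_iff.1 hbot
  obtain ⟨f, hf, hfW⟩ := W.exists_le_ker_of_lt_top (lt_top_iff_ne_top.2 htop)
  set u : Fin d → ℚ := fun i => f (Pi.single i 1) with hu
  have hfu : ∀ x, f x = ∑ i, u i * x i := fun x => by
    conv_lhs => rw [← Finset.univ_sum_single x, map_sum]
    refine Finset.sum_congr rfl fun i _ => ?_
    rw [hu, mul_comm, ← smul_eq_mul, ← map_smul, ← Pi.single_smul, smul_eq_mul, mul_one]
  have hu0 : u ≠ 0 := by
    rintro h
    apply hf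
    ext i
    simpa [hu] using congrFun h i
  have hval : ∀ γ ∈ Subgroup.closure S, f (ratAction γ w) = 0 := fun γ hγ =>
    hfW (ratAction_mem_of_mem_closure hinv hγ w hwW)
  let p : MvPolynomial (Fin d × Fin d) ℚ :=
    ∑ i, ∑ j, MvPolynomial.C (u i * w j) * MvPolynomial.X (i, j)
  have hp := hS p fun γ hγ => by
    rw [← hval γ hγ, hfu]
    simp only [p, map_sum, map_mul, MvPolynomial.aeval_C, MvPolynomial.aeval_X, ratAction,
      toLin'_apply, mulVec, dotProduct, Finset.mul_sum, map_apply]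
    refine Finset.sum_congr rfl fun i _ => Finset.sum_congr rfl fun j _ => ?_
    simp only [Algebra.algebraMap_self, RingHom.id_apply]
    ring
  obtain ⟨g, hg⟩ := exists_specialLinear_dotProduct_ne_zero
    (u := fun i => (u i : ℂ)) (w := fun i => (w i : ℂ))
    (fun h => hu0 (funext fun i => by simpa using congrFun h i))
    (fun h => hw (funext fun i => by simpa using congrFun h i))
  apply hg
  rw [← hp g]
  simp only [p, map_sum, map_mul, MvPolynomial.aeval_C, MvPolynomial.aeval_X,
    mulVec, dotProduct, Finset.mul_sum]
  refine Finset.sum_congr rfl fun i _ => Finset.sum_congr rfl fun j _ => ?_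
  simp only [eq_ratCast]
  ring

theorem latticeVec_ne_zero_of {d : ℕ} {g : Matrix (Fin d) (Fin d) ℝ} {n : Fin d → ℤ}
    (h : latticeVec g n ≠ 0) : n ≠ 0 := by
  rintro rfl
  apply h
  ext i
  simp [latticeVec, Matrix.mulVec, dotProduct]

open MeasureTheory Matrix in
/-- Minkowski: a unimodular lattice contains a nonzero vector in the unit cube. -/
theorem exists_latticeVec_norm_le_one {d : ℕ} (hd : 0 < d) {g : Matrix (Fin d) (Fin d) ℝ}
    (hg : g.det = 1) : ∃ n : Fin d → ℤ, n ≠ 0 ∧ ‖latticeVec g n‖ ≤ 1 := by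
  have : Nonempty (Fin d) := ⟨⟨0, hd⟩⟩
  have hdT : gᵀ.det = 1 := by rw [Matrix.det_transpose, hg]
  have hli : LinearIndependent ℝ gᵀ.row :=
    Matrix.linearIndependent_rows_iff_isUnit.2 ((Matrix.isUnit_iff_isUnit_det _).2 (by simp [hdT]))
  let b : Module.Basis (Fin d) ℝ (Fin d → ℝ) :=
    basisOfLinearIndependentOfCardEqFinrank hli (by simp)
  have hb : ⇑b = gᵀ.row := coe_basisOfLinearIndependentOfCardEqFinrank hli (by simp)
  have hvol : volume (ZSpan.fundamentalDomain b) = 1 := by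
    rw [ZSpan.volume_fundamentalDomain, hb]
    change ENNReal.ofReal |gᵀ.det| = 1
    simp [hdT]
  have : Countable (Submodule.span ℤ (Set.range b)).toAddSubgroup :=
    inferInstanceAs (Countable (Submodule.span ℤ (Set.range b)))
  obtain ⟨x, hx0, hx⟩ := exists_ne_zero_mem_lattice_of_measure_mul_two_pow_le_measure
    (ZSpan.isAddFundamentalDomain' b volume) (s := Metric.closedBall (0 : Fin d → ℝ) 1)
    (by simp) (convex_closedBall _ _) (isCompact_closedBall _ _)
    (by rw [hvol, Real.volume_pi_closedBall _ zero_le_one]; simp)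
  obtain ⟨c, hc⟩ := (Submodule.mem_span_range_iff_exists_fun ℤ).1 x.2
  have hcx : latticeVec g c = x := by
    rw [← hc, hb]
    ext i
    simp [latticeVec, Matrix.mulVec, dotProduct, Matrix.row, mul_comm]
  refine ⟨c, latticeVec_ne_zero_of (g := g) ?_, ?_⟩
  · rw [hcx]
    exact fun h => hx0 (Subtype.ext h)
  · rw [hcx]
    simpa using hx

/-- If every generator expands the lattice `g ℤ^d` by a factor of at most `M`, then the lattice
contains `d` independent vectors of norm at most `M ^ d`. -/
theorem ZariskiDenseSLZ.exists_linearIndependent {d : ℕ}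
    {S : Set (Matrix.SpecialLinearGroup (Fin d) ℤ)}
    (hS : ZariskiDenseSLZ d (Subgroup.closure S)) {g : Matrix (Fin d) (Fin d) ℝ}
    (hg : g.det = 1) {M : ℝ} (hM : 1 ≤ M)
    (hexp : ∀ σ ∈ S, ∀ x : Fin d → ℤ,
      ‖latticeVec g ((σ : Matrix (Fin d) (Fin d) ℤ).mulVec x)‖ ≤ M * ‖latticeVec g x‖)
    {k : ℕ} (hk : k ≤ d) :
    ∃ v : Fin k → Fin d → ℤ, LinearIndependent ℚ (fun i j => (v i j : ℚ)) ∧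
      ∀ i, ‖latticeVec g (v i)‖ ≤ M ^ k := by
  induction k with
  | zero => exact ⟨Fin.elim0, linearIndependent_empty_type, fun i => i.elim0⟩
  | succ k ih =>
    obtain ⟨v, hv, hvM⟩ := ih (by omega)
    have hpow : M ^ k ≤ M ^ (k + 1) := pow_le_pow_right₀ hM (by omega)
    set vq : Fin k → Fin d → ℚ := fun i j => (v i j : ℚ) with hvq
    obtain ⟨n, hn, hnM⟩ : ∃ n : Fin d → ℤ,
        (fun j => (n j : ℚ)) ∉ Submodule.span ℚ (Set.range vq) ∧
          ‖latticeVec g n‖ ≤ M ^ (k + 1) := by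
      rcases Nat.eq_zero_or_pos k with rfl | hk0
      · obtain ⟨n, hn, hn1⟩ := exists_latticeVec_norm_le_one (by omega) hg
        refine ⟨n, ?_, hn1.trans (one_le_pow₀ hM)⟩
        rw [Set.range_eq_empty, Submodule.span_empty, Submodule.mem_bot]
        exact fun h => hn (funext fun j => by simpa using congrFun h j)
      · obtain ⟨σ, hσ, w, hw, hσw⟩ := hS.exists_ratAction_notMem
          (W := Submodule.span ℚ (Set.range vq))
          (Submodule.ne_bot_iff _ |>.2 ⟨vq ⟨0, hk0⟩, Submodule.subset_span ⟨_, rfl⟩,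
            hv.ne_zero _⟩)
          (fun h => by
            have h1 := finrank_span_eq_card hv
            rw [h, finrank_top] at h1
            simp at h1
            omega)
        obtain ⟨i, hi⟩ : ∃ i, ratAction σ (vq i) ∉ Submodule.span ℚ (Set.range vq) := by
          by_contra! hc
          have hle : Submodule.span ℚ (Set.range vq) ≤
              (Submodule.span ℚ (Set.range vq)).comap (ratAction σ) :=
            Submodule.span_le.2 (by rintro _ ⟨i, rfl⟩; exact hc i)
          exact hσw (hle hw)
        refine ⟨_, (ratAction_intCast σ (v i)) ▸ hi, (hexp σ hσ _).trans ?_⟩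
        rw [pow_succ']
        gcongr
        exact hvM i
    refine ⟨Fin.snoc v n, ?_, fun i => ?_⟩
    · have : (fun i j => ((Fin.snoc v n : Fin (k + 1) → Fin d → ℤ) i j : ℚ)) =
          (Fin.snoc vq (fun j => (n j : ℚ)) : Fin (k + 1) → Fin d → ℚ) := by
        funext i
        refine Fin.lastCases ?_ (fun i => ?_) i <;> simp [hvq]
      rw [this, linearIndependent_finSnoc]
      exact ⟨hv, hn⟩
    · refine Fin.lastCases ?_ (fun i => ?_) i
      · simpa using hnM
      · simpa using (hvM i).trans hpow

open Matrix in
/-- If the determinant of an integer matrix is not a unit, one can replace a column so that the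
determinant is nonzero and at least halved. The columns keep being short. -/
theorem exists_det_descent {d : ℕ} {g : Matrix (Fin d) (Fin d) ℝ}
    {N : Matrix (Fin d) (Fin d) ℤ} (h0 : N.det ≠ 0) (h1 : ¬ IsUnit N.det) {R : ℝ}
    (hR : ∀ i, ‖latticeVec g (N.col i)‖ ≤ R) :
    ∃ N' : Matrix (Fin d) (Fin d) ℤ, N'.det ≠ 0 ∧ 2 * |(N'.det : ℝ)| ≤ |(N.det : ℝ)| ∧
      ∀ i, ‖latticeVec g (N'.col i)‖ ≤ 2 ^ d * R := by
  set D := N.det with hD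
  have hDR : (D : ℝ) ≠ 0 := by exact_mod_cast h0
  obtain ⟨i₀, j₀, hij⟩ : ∃ i j, ¬ D ∣ N.adjugate i j := by
    by_contra! hc
    choose Q hQ using hc
    apply h1
    have hadj : N.adjugate = D • Matrix.of Q := by
      ext i j
      simp [hQ i j]
    have h2 := N.mul_adjugate
    rw [hadj, Matrix.mul_smul, ← hD] at h2
    have h3 : N * Matrix.of Q = 1 := smul_right_injective _ h0 h2
    exact IsUnit.of_mul_eq_one _ (by rw [hD, ← det_mul, h3, det_one])
  set z : Fin d → ℤ := N.adjugate.col j₀ with hz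
  set q : Fin d → ℤ := fun i => round ((z i : ℝ) / D) with hq
  set r : Fin d → ℤ := z - D • q with hr
  have hrD : ∀ i, |(r i : ℝ) / D| ≤ 1 / 2 := fun i => by
    have : (r i : ℝ) / D = (z i : ℝ) / D - q i := by
      simp only [hr, Pi.sub_apply, Pi.smul_apply, smul_eq_mul]
      push_cast
      field_simp
    rw [this]
    exact abs_sub_round _
  set n : Fin d → ℤ := Pi.single j₀ 1 - N *ᵥ q with hn
  have hadjn : N.adjugate *ᵥ n = r := by
    rw [hn, mulVec_sub, mulVec_mulVec, adjugate_mul, smul_mulVec, one_mulVec, hr, hz,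
      mulVec_single_one]
  have hNr : N *ᵥ r = D • n := by
    rw [← hadjn, mulVec_mulVec, mul_adjugate, smul_mulVec, one_mulVec]
  have hR0 : 0 ≤ R := (norm_nonneg _).trans (hR i₀)
  have hd2 : (d : ℝ) ≤ 2 ^ d := by exact_mod_cast Nat.lt_two_pow_self.le
  have hnR : ‖latticeVec g n‖ ≤ 2 ^ d * R := by
    have hexp : latticeVec g n = ∑ i, ((r i : ℝ) / D) • latticeVec g (N.col i) := by
      have h2 : (fun j => (n j : ℝ)) = ∑ i, ((r i : ℝ) / D) • fun j => (N.col i j : ℝ) := by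
        funext j
        have h3 : ((N *ᵥ r) j : ℝ) = D * n j := by rw [hNr]; simp
        rw [← mul_right_inj' hDR, ← h3]
        simp only [mulVec, dotProduct, Finset.sum_apply, Pi.smul_apply, smul_eq_mul, col_apply,
          Finset.mul_sum]
        push_cast
        refine Finset.sum_congr rfl fun i _ => ?_
        field_simp
      simp only [latticeVec]
      rw [h2, mulVec_sum]
      simp only [mulVec_smul]
    rw [hexp]
    calc _ ≤ ∑ i : Fin d, 1 / 2 * R := norm_sum_le_of_le _ fun i _ => by
            rw [norm_smul]
            exact mul_le_mul (hrD i) (hR i) (norm_nonneg _) (by norm_num)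
      _ = d * (1 / 2 * R) := by simp
      _ ≤ 2 ^ d * R := mul_le_mul hd2 (by linarith) (by positivity) (by positivity)
  have hri : r i₀ ≠ 0 := fun h => hij ⟨q i₀, by
    simpa [hr, hz, sub_eq_zero] using h⟩
  have hdet : (N.updateCol i₀ n).det = r i₀ := by
    rw [← cramer_apply, cramer_eq_adjugate_mulVec, hadjn]
  refine ⟨N.updateCol i₀ n, hdet ▸ hri, ?_, fun i => ?_⟩
  · rw [hdet]
    have := hrD i₀
    rw [abs_div, div_le_iff₀ (abs_pos.2 hDR)] at this
    linarith
  · by_cases hi : i = i₀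
    · subst hi
      have : (N.updateCol i n).col i = n := by
        ext j
        simp
      rwa [this]
    · have : (N.updateCol i₀ n).col i = N.col i := by
        ext j
        simp [hi]
      rw [this]
      have h2 : (1 : ℝ) ≤ 2 ^ d := one_le_pow₀ (by norm_num)
      exact (hR i).trans (le_mul_of_one_le_left hR0 h2)

/-- Independent vectors of norm at most `R` in the lattice `g ℤ^d` can be replaced by a basis whose
norms are controlled polynomially in the index. -/
theorem exists_isUnit_det {d : ℕ} {g : Matrix (Fin d) (Fin d) ℝ}
    (N : Matrix (Fin d) (Fin d) ℤ) (h0 : N.det ≠ 0) {R : ℝ} (hR0 : 0 ≤ R)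
    (hR : ∀ i, ‖latticeVec g (N.col i)‖ ≤ R) :
    ∃ P : Matrix (Fin d) (Fin d) ℤ, IsUnit P.det ∧
      ∀ i, ‖latticeVec g (P.col i)‖ ≤ R * |(N.det : ℝ)| ^ d := by
  induction hm : N.det.natAbs using Nat.strong_induction_on generalizing N R with
  | _ m ih =>
    by_cases h1 : IsUnit N.det
    · refine ⟨N, h1, fun i => (hR i).trans ?_⟩
      have : |(N.det : ℝ)| = 1 := by
        rcases Int.isUnit_iff.1 h1 with h | h <;> simp [h]
      simp [this]
    · obtain ⟨N', h0', hhalf, hN'⟩ := exists_det_descent h0 h1 hR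
      have hpos : 0 < |(N'.det : ℝ)| := abs_pos.2 (by exact_mod_cast h0')
      have hlt : N'.det.natAbs < m := by
        rw [← hm]
        have : |(N'.det : ℝ)| < |(N.det : ℝ)| := by linarith
        have : |N'.det| < |N.det| := by exact_mod_cast this
        zify
        exact this
      obtain ⟨P, hP, hPR⟩ := ih _ hlt N' h0' (by positivity) hN' rfl
      refine ⟨P, hP, fun i => (hPR i).trans ?_⟩
      calc 2 ^ d * R * |(N'.det : ℝ)| ^ d = R * (2 * |(N'.det : ℝ)|) ^ d := by ring
        _ ≤ R * |(N.det : ℝ)| ^ d := by gcongr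

/-- Version of `exists_isUnit_det` with determinant `1`. -/
theorem exists_specialLinear {d : ℕ} (hd : 0 < d) {g : Matrix (Fin d) (Fin d) ℝ}
    (N : Matrix (Fin d) (Fin d) ℤ) (h0 : N.det ≠ 0) {R : ℝ} (hR0 : 0 ≤ R)
    (hR : ∀ i, ‖latticeVec g (N.col i)‖ ≤ R) :
    ∃ γ : Matrix.SpecialLinearGroup (Fin d) ℤ,
      ∀ i, ‖latticeVec g ((γ : Matrix (Fin d) (Fin d) ℤ).col i)‖ ≤ R * |(N.det : ℝ)| ^ d := by
  obtain ⟨P, hP, hPR⟩ := exists_isUnit_det N h0 hR0 hR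
  rcases Int.isUnit_iff.1 hP with h | h
  · exact ⟨⟨P, h⟩, hPR⟩
  · refine ⟨⟨P.updateCol ⟨0, hd⟩ ((-1 : ℤ) • P.col ⟨0, hd⟩), ?_⟩, fun i => ?_⟩
    · rw [Matrix.det_updateCol_smul]
      have : P.updateCol ⟨0, hd⟩ (P.col ⟨0, hd⟩) = P := Matrix.updateCol_eq_self _ _
      rw [this, h]
      norm_num
    · refine le_trans (le_of_eq ?_) (hPR i)
      by_cases hi : i = ⟨0, hd⟩
      · subst hi
        have : (P.updateCol ⟨0, hd⟩ ((-1 : ℤ) • P.col ⟨0, hd⟩)).col ⟨0, hd⟩ =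
            -P.col ⟨0, hd⟩ := by
          ext j
          simp
        have h2 : latticeVec g (-P.col ⟨0, hd⟩) = -latticeVec g (P.col ⟨0, hd⟩) := by
          rw [latticeVec, latticeVec, ← Matrix.mulVec_neg]
          congr 1
          ext j
          simp
        dsimp only
        rw [this, h2, norm_neg]
      · congr 2
        ext j
        simp [hi]

theorem abs_entry_le_opNormR {d : ℕ} (A : Matrix (Fin d) (Fin d) ℝ) (i j : Fin d) :
    |A i j| ≤ opNormR A := by
  have h := (LinearMap.toContinuousLinearMap (Matrix.toEuclideanLin A)).le_opNorm
    (EuclideanSpace.single j (1 : ℝ))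
  have h2 := PiLp.norm_apply_le (LinearMap.toContinuousLinearMap (Matrix.toEuclideanLin A)
    (EuclideanSpace.single j (1 : ℝ))) i
  have h3 : (LinearMap.toContinuousLinearMap (Matrix.toEuclideanLin A)
    (EuclideanSpace.single j (1 : ℝ))) i = A i j := by
    simp [Matrix.toEuclideanLin]
  rw [h3, Real.norm_eq_abs] at h2
  refine h2.trans (h.trans ?_)
  simp [opNormR]

theorem opNormR_le {d : ℕ} {A : Matrix (Fin d) (Fin d) ℝ} {B : ℝ} (hB0 : 0 ≤ B)
    (hB : ∀ i j, |A i j| ≤ B) : opNormR A ≤ d * (d * B) := by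
  refine ContinuousLinearMap.opNorm_le_bound _ (by positivity) fun x => ?_
  have hentry : ∀ i, ‖Matrix.toEuclideanLin A x i‖ ≤ d * B * ‖x‖ := fun i => by
    have : Matrix.toEuclideanLin A x i = ∑ j, A i j * x j := rfl
    rw [this]
    calc _ ≤ ∑ j : Fin d, B * ‖x‖ := norm_sum_le_of_le _ fun j _ => by
            rw [norm_mul]
            exact mul_le_mul (hB i j) (PiLp.norm_apply_le x j) (norm_nonneg _) hB0
      _ = d * B * ‖x‖ := by simp [mul_assoc]
  have hsum : ‖Matrix.toEuclideanLin A x‖ ≤ ∑ i, ‖Matrix.toEuclideanLin A x i‖ := by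
    rw [EuclideanSpace.norm_eq]
    refine Real.sqrt_le_iff.2 ⟨by positivity, ?_⟩
    exact Finset.sum_sq_le_sq_sum_of_nonneg fun i _ => norm_nonneg _
  calc _ ≤ ∑ i : Fin d, ‖Matrix.toEuclideanLin A x i‖ := hsum
    _ ≤ ∑ i : Fin d, d * B * ‖x‖ := Finset.sum_le_sum fun i _ => hentry i
    _ = d * (d * B) * ‖x‖ := by simp; ring

theorem abs_det_le {d : ℕ} {A : Matrix (Fin d) (Fin d) ℝ} {x : ℝ} (h : ∀ i j, |A i j| ≤ x) :
    |A.det| ≤ d.factorial * x ^ d := by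
  simpa using Matrix.det_le (abv := AbsoluteValue.abs) h

/-- Quantitative form: if the generators have displacement at most `m`, the coset of `g` is at
distance polynomial in `m`. -/
theorem ZariskiDenseSLZ.exists_opNormR_le {d : ℕ} (hd : 0 < d)
    {S : Set (Matrix.SpecialLinearGroup (Fin d) ℤ)} (hne : S.Nonempty)
    (hS : ZariskiDenseSLZ d (Subgroup.closure S)) (g : Matrix.SpecialLinearGroup (Fin d) ℝ) {m : ℝ}
    (hm : ∀ σ ∈ S, opNormR ((g : Matrix (Fin d) (Fin d) ℝ) * intMat σ *
      ((g⁻¹ : Matrix.SpecialLinearGroup (Fin d) ℝ) : Matrix (Fin d) (Fin d) ℝ)) ≤ m) :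
    ∃ γ : Matrix.SpecialLinearGroup (Fin d) ℤ,
      opNormR ((g : Matrix (Fin d) (Fin d) ℝ) * intMat γ) ≤
        d * (d * d.factorial ^ d) * (d.factorial * m) ^ (d + d * d * d) := by
  set G := (g : Matrix (Fin d) (Fin d) ℝ) with hG
  set G' := ((g⁻¹ : Matrix.SpecialLinearGroup (Fin d) ℝ) : Matrix (Fin d) (Fin d) ℝ) with hG'
  have hGG : G' * G = 1 := by
    rw [hG, hG', ← Matrix.SpecialLinearGroup.coe_mul, inv_mul_cancel,
      Matrix.SpecialLinearGroup.coe_one]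
  have hdetG : G.det = 1 := g.2
  have hdetG' : G'.det = 1 := (g⁻¹).2
  have hdetint : ∀ γ : Matrix.SpecialLinearGroup (Fin d) ℤ, (intMat γ).det = 1 := fun γ => by
    have := (Int.castRingHom ℝ).map_det (γ : Matrix (Fin d) (Fin d) ℤ)
    rw [γ.2, map_one] at this
    exact this.symm
  obtain ⟨σ₀, hσ₀⟩ := hne
  have hm0 : 0 ≤ m := (norm_nonneg _).trans (hm σ₀ hσ₀)
  have hfac : (d : ℝ) ≤ d.factorial := by exact_mod_cast Nat.self_le_factorial d
  have hM : 1 ≤ d.factorial * m := by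
    have h1 := abs_det_le fun i j => (abs_entry_le_opNormR _ i j).trans (hm σ₀ hσ₀)
    rw [Matrix.det_mul, Matrix.det_mul, hdetG, hdetG', hdetint] at h1
    norm_num at h1
    by_contra! hlt
    have hf1 : (1 : ℝ) ≤ d.factorial := by exact_mod_cast Nat.factorial_pos d
    have hm1 : m ≤ 1 := by nlinarith
    have : m ^ d ≤ m := pow_le_of_le_one hm0 hm1 (by omega)
    nlinarith
  set M : ℝ := d.factorial * m with hMdef
  have hM0 : 0 ≤ M := by linarith
  have hexp : ∀ σ ∈ S, ∀ x : Fin d → ℤ,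
      ‖latticeVec G ((σ : Matrix (Fin d) (Fin d) ℤ).mulVec x)‖ ≤ M * ‖latticeVec G x‖ := by
    intro σ hσ x
    have heq : latticeVec G ((σ : Matrix (Fin d) (Fin d) ℤ).mulVec x) =
        (G * intMat σ * G').mulVec (latticeVec G x) := by
      rw [latticeVec, latticeVec, Matrix.mulVec_mulVec, Matrix.mul_assoc, hGG, Matrix.mul_one,
        ← Matrix.mulVec_mulVec]
      congr 1
      ext j
      simp [intMat, Matrix.mulVec, dotProduct]
    rw [heq]
    refine (pi_norm_le_iff_of_nonneg (by positivity)).2 fun i => ?_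
    calc _ ≤ ∑ j : Fin d, m * ‖latticeVec G x‖ := norm_sum_le_of_le _ fun j _ => by
            rw [norm_mul]
            exact mul_le_mul ((abs_entry_le_opNormR _ i j).trans (hm σ hσ)) (norm_le_pi_norm _ j)
              (norm_nonneg _) hm0
      _ = d * m * ‖latticeVec G x‖ := by simp [mul_assoc]
      _ ≤ M * ‖latticeVec G x‖ := by rw [hMdef]; gcongr
  obtain ⟨v, hv, hvM⟩ := hS.exists_linearIndependent hdetG hM hexp le_rfl
  set N : Matrix (Fin d) (Fin d) ℤ := (Matrix.of v).transpose with hN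
  have hcol : ∀ i, N.col i = v i := fun i => rfl
  have hdetN : N.det ≠ 0 := by
    intro h
    have hu := Matrix.linearIndependent_rows_iff_isUnit
      (A := (Matrix.of v).map (Int.castRingHom ℚ)) |>.1 hv
    rw [Matrix.isUnit_iff_isUnit_det, ← RingHom.mapMatrix_apply, ← RingHom.map_det,
      ← Matrix.det_transpose, ← hN, h] at hu
    simp at hu
  have hdetbound : |(N.det : ℝ)| ≤ d.factorial * (M ^ d) ^ d := by
    have h1 : (G * N.map (Int.castRingHom ℝ)).det = N.det := by
      rw [Matrix.det_mul, hdetG, one_mul, ← RingHom.mapMatrix_apply, ← RingHom.map_det]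
      rfl
    rw [← h1]
    refine abs_det_le fun i j => ?_
    exact (norm_le_pi_norm (latticeVec G (v j)) i).trans (hvM j)
  obtain ⟨γ, hγ⟩ := exists_specialLinear hd (g := G) N hdetN (pow_nonneg hM0 d)
    (fun i => (hcol i).symm ▸ hvM i)
  refine ⟨γ, (opNormR_le (B := M ^ d * (d.factorial * (M ^ d) ^ d) ^ d) (by positivity)
    fun i j => ?_).trans (le_of_eq ?_)⟩
  · refine (norm_le_pi_norm (latticeVec G ((γ : Matrix (Fin d) (Fin d) ℤ).col j)) i).trans
      ((hγ j).trans ?_)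
    gcongr
  · rw [mul_pow, pow_add, pow_mul, pow_mul]
    ring

theorem stmt11 {d : ℕ} (hd : 2 ≤ d) :
    ∃ C₁ : ℝ, 0 < C₁ ∧ ∃ C₂ : ℝ, 0 < C₂ ∧
      ∀ S : Finset (Matrix.SpecialLinearGroup (Fin d) ℤ),
        ZariskiDenseSLZ d (Subgroup.closure (S : Set (Matrix.SpecialLinearGroup (Fin d) ℤ))) →
        ∀ g : Matrix.SpecialLinearGroup (Fin d) ℝ,
          ∃ σ ∈ S,
            C₂ * (⨅ γ : Matrix.SpecialLinearGroup (Fin d) ℤ,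
                opNormR ((g : Matrix (Fin d) (Fin d) ℝ) * intMat γ)) ^ C₁ ≤
              opNormR ((g : Matrix (Fin d) (Fin d) ℝ) * intMat σ *
                ((g⁻¹ : Matrix.SpecialLinearGroup (Fin d) ℝ) : Matrix (Fin d) (Fin d) ℝ)) := by
  have hd0 : 0 < d := by omega
  set K : ℕ := d + d * d * d with hK
  have hK0 : (K : ℝ) ≠ 0 := by positivity
  set A : ℝ := d * (d * d.factorial ^ d) * (d.factorial : ℝ) ^ K with hA
  have hA0 : 0 < A := by positivity
  refine ⟨(K : ℝ)⁻¹, by positivity, (A ^ (K : ℝ)⁻¹)⁻¹, by positivity, fun S hS g => ?_⟩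
  have hne : S.Nonempty := by
    have hdne : (⟨0, hd0⟩ : Fin d) ≠ ⟨1, hd⟩ := by simp
    obtain ⟨σ, hσ, _⟩ := hS.exists_ratAction_notMem
      (W := LinearMap.ker (LinearMap.proj (R := ℚ) (φ := fun _ : Fin d => ℚ) ⟨0, hd0⟩))
      (Submodule.ne_bot_iff _ |>.2 ⟨Pi.single ⟨1, hd⟩ 1, by simp [hdne], by simp⟩)
      (fun h => by
        have h1 : (Pi.single ⟨0, hd0⟩ 1 : Fin d → ℚ) ∈ LinearMap.ker
            (LinearMap.proj (R := ℚ) (φ := fun _ : Fin d => ℚ) ⟨0, hd0⟩) := h ▸ Submodule.mem_top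
        simp at h1)
    exact ⟨σ, hσ⟩
  obtain ⟨σ, hσ, hmax⟩ := S.exists_max_image (fun σ => opNormR ((g : Matrix (Fin d) (Fin d) ℝ) *
    intMat σ * ((g⁻¹ : Matrix.SpecialLinearGroup (Fin d) ℝ) : Matrix (Fin d) (Fin d) ℝ))) hne
  refine ⟨σ, hσ, ?_⟩
  obtain ⟨γ, hγ⟩ := hS.exists_opNormR_le hd0 hne g hmax
  set m := opNormR ((g : Matrix (Fin d) (Fin d) ℝ) *
    intMat σ * ((g⁻¹ : Matrix.SpecialLinearGroup (Fin d) ℝ) : Matrix (Fin d) (Fin d) ℝ)) with hm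
  have hm0 : 0 ≤ m := norm_nonneg _
  have hI : (⨅ γ : Matrix.SpecialLinearGroup (Fin d) ℤ,
      opNormR ((g : Matrix (Fin d) (Fin d) ℝ) * intMat γ)) ≤ A * m ^ K := by
    refine (ciInf_le ⟨0, ?_⟩ γ).trans (hγ.trans (le_of_eq ?_))
    · rintro _ ⟨γ, rfl⟩
      exact norm_nonneg _
    · rw [hA, mul_pow]
      ring
  rw [inv_mul_le_iff₀ (by positivity)]
  calc _ ≤ (A * m ^ K) ^ (K : ℝ)⁻¹ :=
        Real.rpow_le_rpow (Real.iInf_nonneg fun _ => norm_nonneg _) hI (by positivity)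
    _ = A ^ (K : ℝ)⁻¹ * m := by
        rw [Real.mul_rpow hA0.le (by positivity), Real.pow_rpow_inv_natCast hm0 (by positivity)]
end

section
/- Let d ≥ 2. There exist positive constants k and l (depending only on d) such that for every g ∈ SL_d(ℝ) there exists a nontrivial unipotent element γ ∈ SL_d(ℤ), γ ≠ 1 with (γ − 1)^d = 0, satisfying ‖g γ g⁻¹ − 1‖ ≤ l · (inf_{δ ∈ SL_d(ℤ)} ‖g δ‖)^{−k}. -/
section

open Module WithLp Matrix

/-- A vector of a uniformly discrete subgroup that is almost as short as possible. -/
theorem exists_almost_shortest_mem {E : Type*} [NormedAddCommGroup E] (Λ : Submodule ℤ E)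
    (hne : Λ ≠ ⊥) {ε : ℝ} (hε : 0 < ε) (hΛ : ∀ y ∈ Λ, y ≠ 0 → ε ≤ ‖y‖) :
    ∃ x ∈ Λ, x ≠ 0 ∧ ∀ y ∈ Λ, y ≠ 0 → ‖x‖ ≤ 7 / 5 * ‖y‖ := by
  set S : Set ℝ := {r | ∃ y ∈ Λ, y ≠ 0 ∧ ‖y‖ = r}
  obtain ⟨z, hz, hz0⟩ := Submodule.exists_mem_ne_zero_of_ne_bot hne
  have hS : S.Nonempty := ⟨_, z, hz, hz0, rfl⟩
  have hlow : ε ≤ sInf S := le_csInf hS (by rintro _ ⟨y, hy, hy0, rfl⟩; exact hΛ y hy hy0)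
  obtain ⟨_, ⟨x, hx, hx0, rfl⟩, hlt⟩ :=
    exists_lt_of_csInf_lt hS (show sInf S < 7 / 5 * sInf S by linarith)
  refine ⟨x, hx, hx0, fun y hy hy0 => hlt.le.trans ?_⟩
  have : sInf S ≤ ‖y‖ :=
    csInf_le ⟨ε, by rintro _ ⟨y, hy, hy0, rfl⟩; exact hΛ y hy hy0⟩ ⟨y, hy, hy0, rfl⟩
  linarith

/-- Quotienting a finitely generated torsion-free subgroup by the kernel of a linear map
lowers the rank by one if this kernel is infinite cyclic. -/
theorem finrank_map_add_one_of_ker_eq_span_singleton {E : Type*} [AddCommGroup E]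
    [IsAddTorsionFree E] (Λ : Submodule ℤ E) [Module.Finite ℤ Λ] (f : E →ₗ[ℤ] E) {x : E}
    (hx : x ∈ Λ) (hx0 : x ≠ 0) (hfx : f x = 0)
    (hker : ∀ y ∈ Λ, f y = 0 → ∃ n : ℤ, y = n • x) :
    finrank ℤ (Λ.map f) + 1 = finrank ℤ Λ := by
  set F : Λ →ₗ[ℤ] E := f ∘ₗ Λ.subtype with hF
  have hr : LinearMap.range F = Λ.map f := by
    rw [hF, LinearMap.range_comp, Submodule.range_subtype]
  have hk : LinearMap.ker F = Submodule.span ℤ {(⟨x, hx⟩ : Λ)} := by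
    apply le_antisymm
    · rintro ⟨y, hy⟩ hyF
      obtain ⟨n, hn⟩ := hker y hy (by simpa [hF] using hyF)
      exact Submodule.mem_span_singleton.2 ⟨n, Subtype.ext hn.symm⟩
    · rw [Submodule.span_singleton_le_iff_mem]
      simpa [hF] using hfx
  have hk1 : finrank ℤ (LinearMap.ker F) = 1 := by
    rw [hk, ← (LinearEquiv.toSpanNonzeroSingleton ℤ Λ ⟨x, hx⟩
      (by simpa [Subtype.ext_iff] using hx0)).finrank_eq, finrank_self]
  rw [← Submodule.finrank_quotient_add_finrank (LinearMap.ker F), hk1,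
    F.quotKerEquivRange.finrank_eq, hr]

open scoped RealInnerProductSpace in
/-- Lattice reduction in the style of Korkine and Zolotarev: a uniformly discrete subgroup of rank
`n + 1` is spanned by vectors `b 0, …, b n` with `b 0` almost shortest, and whose norms are
controlled by the inverse of the norm of a vector `w` dual to the last one. -/
theorem exists_reduced_spanning_family {E : Type*} [NormedAddCommGroup E]
    [InnerProductSpace ℝ E] (n : ℕ) (Λ : Submodule ℤ E) [Module.Finite ℤ Λ]
    (hrank : finrank ℤ Λ = n + 1) {ε : ℝ} (hε : 0 < ε) (hΛ : ∀ y ∈ Λ, y ≠ 0 → ε ≤ ‖y‖) :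
    ∃ b : Fin (n + 1) → E, Submodule.span ℤ (Set.range b) = Λ ∧
      (∀ y ∈ Λ, y ≠ 0 → ‖b 0‖ ≤ 2 * ‖y‖) ∧
      ∃ w : E, (∀ i, ⟪w, b i⟫ = if i = Fin.last n then 1 else 0) ∧
        ∀ i, ‖b i‖ * ‖w‖ ≤ 2 ^ n := by
  induction n using Nat.strong_induction_on generalizing Λ ε with
  | h n ih =>
  have : IsAddTorsionFree E := .of_isTorsionFree ℝ E
  have hne : Λ ≠ ⊥ := by
    rintro rfl
    simp at hrank
  obtain ⟨x, hx, hx0, hmin⟩ := exists_almost_shortest_mem Λ hne hε hΛ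
  have hxpos : 0 < ‖x‖ := norm_pos_iff.2 hx0
  set π : E →L[ℝ] E := (ℝ ∙ x)ᗮ.starProjection with hπ
  have hdec (y : E) : ∃ t : ℝ, y = π y + t • x := by
    have h : y - π y ∈ (ℝ ∙ x) := by
      have := (ℝ ∙ x)ᗮ.sub_starProjection_mem_orthogonal y
      rwa [Submodule.orthogonal_orthogonal] at this
    obtain ⟨t, ht⟩ := Submodule.mem_span_singleton.1 h
    exact ⟨t, by rw [ht]; abel⟩
  have horth (y : E) : ⟪x, π y⟫ = 0 :=
    Submodule.mem_orthogonal_singleton_iff_inner_right.1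
      (Submodule.starProjection_apply_mem _ y)
  have hπx : π x = 0 := by
    rw [hπ, Submodule.starProjection_apply_eq_zero_iff]
    exact Submodule.le_orthogonal_orthogonal _ (Submodule.mem_span_singleton_self x)
  have hsq (y : E) (t : ℝ) : ‖π y + t • x‖ ^ 2 = ‖π y‖ ^ 2 + t ^ 2 * ‖x‖ ^ 2 := by
    rw [norm_add_sq_real, inner_smul_right, real_inner_comm, horth, norm_smul, mul_pow]
    simp
  have hlift (y : E) (hy : y ∈ Λ) : ∃ n : ℤ, ∃ t : ℝ, t ^ 2 ≤ 1 / 4 ∧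
      y - n • x = π y + t • x := by
    obtain ⟨t, ht⟩ := hdec y
    refine ⟨round t, t - round t, ?_, ?_⟩
    · have := abs_sub_round t
      have h2 : |t - round t| ^ 2 ≤ (1 / 2) ^ 2 := by gcongr
      rw [sq_abs] at h2
      linarith
    · nth_rw 1 [ht]
      rw [sub_smul, Int.cast_smul_eq_zsmul]
      abel
  have hlen (y : E) (t : ℝ) (ht : t ^ 2 ≤ 1 / 4) (hy : π y + t • x ∈ Λ)
      (h0 : π y + t • x ≠ 0) : ‖x‖ ≤ 2 * ‖π y‖ ∧ ‖π y + t • x‖ ≤ 2 * ‖π y‖ := by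
    have h1 : ‖x‖ ^ 2 ≤ (7 / 5 * ‖π y + t • x‖) ^ 2 := by gcongr; exact hmin _ hy h0
    rw [mul_pow, hsq] at h1
    have h2 : t ^ 2 * ‖x‖ ^ 2 ≤ 1 / 4 * ‖x‖ ^ 2 := by gcongr
    have h3 : ‖x‖ ^ 2 ≤ (2 * ‖π y‖) ^ 2 := by nlinarith
    refine ⟨le_of_sq_le_sq h3 (by positivity), le_of_sq_le_sq ?_ (by positivity)⟩
    rw [hsq]
    nlinarith
  have hker (y : E) (hy : y ∈ Λ) (hy0 : π y = 0) : ∃ n : ℤ, y = n • x := by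
    obtain ⟨n, t, ht, h⟩ := hlift y hy
    have hmem := Λ.sub_mem hy (Λ.smul_mem n hx)
    refine ⟨n, sub_eq_zero.1 (by_contra fun h0 => ?_)⟩
    rw [h] at hmem h0
    have := (hlen y t ht hmem h0).1
    rw [hy0, norm_zero] at this
    linarith
  have hfin := finrank_map_add_one_of_ker_eq_span_singleton Λ
    (π.toLinearMap.restrictScalars ℤ) hx hx0 hπx hker
  rw [hrank, Nat.add_right_cancel_iff] at hfin
  set Λ' := Λ.map (π.toLinearMap.restrictScalars ℤ)
  have : Module.Finite ℤ Λ' := inferInstanceAs (Module.Finite ℤ (Λ.map _))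
  cases n with
  | zero =>
    rw [Submodule.finrank_eq_zero] at hfin
    refine ⟨fun _ => x, ?_, fun y hy hy0 => ?_, (‖x‖ ^ 2)⁻¹ • x, fun i => ?_, fun i => ?_⟩
    · rw [Set.range_const]
      refine le_antisymm ((Submodule.span_singleton_le_iff_mem _ _).2 hx) fun y hy => ?_
      have hy0 : π y ∈ Λ' := Submodule.mem_map_of_mem hy
      rw [hfin, Submodule.mem_bot] at hy0
      obtain ⟨n, rfl⟩ := hker y hy hy0
      exact Submodule.smul_mem _ _ (Submodule.mem_span_singleton_self x)
    · linarith [hmin y hy hy0, norm_nonneg y]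
    · rw [if_pos (Subsingleton.elim (α := Fin 1) _ _), real_inner_smul_left, real_inner_self_eq_norm_sq,
        inv_mul_cancel₀ (by positivity)]
    · rw [norm_smul, norm_inv, norm_pow, norm_norm]
      apply le_of_eq
      field_simp
  | succ m =>
    have hΛ'low (y : E) (hy : y ∈ Λ') (hy0 : y ≠ 0) : ‖x‖ / 2 ≤ ‖y‖ := by
      obtain ⟨z, hz, rfl⟩ := hy
      obtain ⟨n, t, ht, h⟩ := hlift z hz
      have hmem := Λ.sub_mem hz (Λ.smul_mem n hx)
      have h0 : z - n • x ≠ 0 := by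
        intro h0
        apply hy0
        simp [sub_eq_zero.1 h0, hπx]
      rw [h] at hmem h0
      have := (hlen z t ht hmem h0).1
      change ‖x‖ / 2 ≤ ‖π z‖
      linarith
    obtain ⟨c, hc, -, w, hw, hcw⟩ := ih m (Nat.lt_succ_self m) Λ' hfin (half_pos hxpos) hΛ'low
    have hcmem (i) : c i ∈ Λ' := hc ▸ Submodule.subset_span (Set.mem_range_self i)
    choose y hy hyc using hcmem
    replace hyc (i) : π (y i) = c i := hyc i
    choose k t ht hkt using fun i => hlift (y i) (hy i)
    have hbmem (i) : y i - k i • x ∈ Λ := Λ.sub_mem (hy i) (Λ.smul_mem _ hx)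
    have hπb (i) : π (y i - k i • x) = c i := by simp [hπx, hyc]
    have hπc (i) : π (c i) = c i := by
      rw [← hyc]
      exact Submodule.starProjection_eq_self_iff.2 (Submodule.starProjection_apply_mem _ _)
    have hπw : ‖π w‖ ≤ ‖w‖ := Submodule.norm_starProjection_apply_le _ _
    have hbnorm (i) : ‖y i - k i • x‖ ≤ 2 * ‖c i‖ := by
      by_cases h0 : y i - k i • x = 0
      · rw [h0, norm_zero]
        positivity
      · have hm := hbmem i
        rw [hkt] at hm h0 ⊢
        rw [← hyc]
        exact (hlen _ _ (ht i) hm h0).2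
    have hclast : c (Fin.last m) ≠ 0 := by
      intro h
      simpa [h] using hw (Fin.last m)
    refine ⟨Fin.cons x fun i => y i - k i • x, ?_, fun z hz hz0 => ?_, π w, ?_, ?_⟩
    · have hxspan : x ∈ Submodule.span ℤ
          (Set.range (Fin.cons x fun i => y i - k i • x : Fin (m + 1 + 1) → E)) :=
        Submodule.subset_span ⟨0, rfl⟩
      apply le_antisymm
      · rw [Submodule.span_le]
        rintro _ ⟨i, rfl⟩
        induction i using Fin.cases with
        | zero => exact hx
        | succ i => exact hbmem i
      · intro z hz
        have hle : Λ' ≤ (Submodule.span ℤ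
            (Set.range (Fin.cons x fun i => y i - k i • x : Fin (m + 1 + 1) → E))).map
            (π.toLinearMap.restrictScalars ℤ) := by
          rw [← hc, Submodule.span_le]
          rintro _ ⟨i, rfl⟩
          exact ⟨_, Submodule.subset_span ⟨i.succ, rfl⟩, hπb i⟩
        obtain ⟨u, hu, huz⟩ := hle (Submodule.mem_map_of_mem hz)
        have huΛ : u ∈ Λ := by
          refine Submodule.span_le.2 ?_ hu
          rintro _ ⟨i, rfl⟩
          induction i using Fin.cases with
          | zero => exact hx
          | succ i => exact hbmem i
        replace huz : π u = π z := huz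
        obtain ⟨n, hn⟩ := hker (z - u) (Λ.sub_mem hz huΛ) (by rw [map_sub, huz, sub_self])
        rw [sub_eq_iff_eq_add.1 hn]
        exact Submodule.add_mem _ (Submodule.smul_mem _ _ hxspan) hu
    · rw [Fin.cons_zero]
      linarith [hmin z hz hz0, norm_nonneg z]
    · intro i
      rw [hπ, Submodule.inner_starProjection_left_eq_right, ← hπ]
      induction i using Fin.cases with
      | zero => simp [hπx, (Fin.last_pos).ne]
      | succ i =>
        rw [Fin.cons_succ, hπb, hw, ← Fin.succ_last]
        simp only [Fin.succ_inj]
    · intro i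
      rw [pow_succ']
      induction i using Fin.cases with
      | zero =>
        have hlast : ‖x‖ ≤ 2 * ‖c (Fin.last m)‖ := by
          linarith [hΛ'low _ (hyc (Fin.last m) ▸ Submodule.mem_map_of_mem (hy _)) hclast]
        calc ‖x‖ * ‖π w‖ ≤ 2 * ‖c (Fin.last m)‖ * ‖w‖ := by gcongr
          _ ≤ 2 * 2 ^ m := by linarith [hcw (Fin.last m)]
      | succ i =>
        calc ‖y i - k i • x‖ * ‖π w‖ ≤ 2 * ‖c i‖ * ‖w‖ := by gcongr; exact hbnorm i
          _ ≤ 2 * 2 ^ m := by linarith [hcw i]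
theorem norm_mulVec_le_opNormR {d : ℕ} (A : Matrix (Fin d) (Fin d) ℝ) (v : Fin d → ℝ) :
    ‖toLp 2 (A *ᵥ v)‖ ≤ opNormR A * ‖toLp 2 v‖ :=
  (LinearMap.toContinuousLinearMap (Matrix.toEuclideanLin A)).le_opNorm (toLp 2 v)

theorem opNormR_le_bound {d : ℕ} (A : Matrix (Fin d) (Fin d) ℝ) {M : ℝ} (hM : 0 ≤ M)
    (h : ∀ v : Fin d → ℝ, ‖toLp 2 (A *ᵥ v)‖ ≤ M * ‖toLp 2 v‖) : opNormR A ≤ M :=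
  ContinuousLinearMap.opNorm_le_bound _ hM fun v => h v.ofLp

theorem opNormR_nonneg {d : ℕ} (A : Matrix (Fin d) (Fin d) ℝ) : 0 ≤ opNormR A :=
  norm_nonneg _

theorem opNormR_le_sum_norm_col {d : ℕ} (A : Matrix (Fin d) (Fin d) ℝ) :
    opNormR A ≤ ∑ j, ‖toLp 2 (Aᵀ j)‖ := by
  refine opNormR_le_bound A (Finset.sum_nonneg fun _ _ => norm_nonneg _) fun v => ?_
  have h : toLp 2 (A *ᵥ v) = ∑ j, v j • toLp 2 (Aᵀ j) := by
    ext i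
    simp [Matrix.mulVec, dotProduct, mul_comm]
  rw [h, Finset.sum_mul]
  refine (norm_sum_le _ _).trans (Finset.sum_le_sum fun j _ => ?_)
  rw [norm_smul, mul_comm]
  gcongr
  exact PiLp.norm_apply_le (toLp 2 v) j

theorem opNormR_vecMulVec_le {d : ℕ} (a b : Fin d → ℝ) :
    opNormR (vecMulVec a b) ≤ ‖toLp 2 a‖ * ‖toLp 2 b‖ := by
  refine opNormR_le_bound _ (by positivity) fun v => ?_
  have h : toLp 2 (vecMulVec a b *ᵥ v) = (b ⬝ᵥ v) • toLp 2 a := by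
    ext i
    simp [vecMulVec_mulVec, mul_comm]
  rw [h, norm_smul, mul_comm, mul_assoc]
  gcongr
  have := abs_real_inner_le_norm (toLp 2 b) (toLp 2 v)
  rwa [EuclideanSpace.inner_toLp_toLp, star_trivial, dotProduct_comm] at this

/-- The parametrization of the lattice `g ℤ^d` by integer vectors, as a `ℤ`-linear map. -/
noncomputable def latticeMap {d : ℕ} (g : SpecialLinearGroup (Fin d) ℝ) :
    (Fin d → ℤ) →ₗ[ℤ] EuclideanSpace ℝ (Fin d) where
  toFun z := toLp 2 ((g : Matrix (Fin d) (Fin d) ℝ) *ᵥ fun i => (z i : ℝ))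
  map_add' x y := by
    rw [← toLp_add, ← mulVec_add]
    congr 2
    ext i
    simp
  map_smul' n x := by
    have : (fun i => ((n • x) i : ℝ)) = (n : ℝ) • fun i => (x i : ℝ) := by
      ext i
      simp
    rw [this, mulVec_smul, toLp_smul, Int.cast_smul_eq_zsmul, RingHom.id_apply]

theorem latticeMap_apply {d : ℕ} (g : SpecialLinearGroup (Fin d) ℝ) (z : Fin d → ℤ) :
    latticeMap g z = toLp 2 ((g : Matrix (Fin d) (Fin d) ℝ) *ᵥ fun i => (z i : ℝ)) := rfl

theorem one_le_norm_intCast {d : ℕ} {z : Fin d → ℤ} (hz : z ≠ 0) :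
    1 ≤ ‖toLp 2 (fun i => (z i : ℝ))‖ := by
  obtain ⟨i, hi⟩ := Function.ne_iff.1 hz
  refine le_trans ?_ (PiLp.norm_apply_le (toLp 2 fun i => (z i : ℝ)) i)
  simpa using (mod_cast Int.one_le_abs hi : (1 : ℝ) ≤ |(z i : ℝ)|)

theorem exists_le_norm_latticeMap {d : ℕ} (g : SpecialLinearGroup (Fin d) ℝ) :
    ∃ ε : ℝ, 0 < ε ∧ ∀ z : Fin d → ℤ, z ≠ 0 → ε ≤ ‖latticeMap g z‖ := by
  set N := opNormR ((g⁻¹ : SpecialLinearGroup (Fin d) ℝ) : Matrix (Fin d) (Fin d) ℝ) with hN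
  have hpos : 0 < N + 1 := by linarith [opNormR_nonneg ((g⁻¹ : SpecialLinearGroup (Fin d) ℝ) : Matrix (Fin d) (Fin d) ℝ)]
  refine ⟨1 / (N + 1), by positivity, fun z hz => ?_⟩
  rw [div_le_iff₀' hpos]
  have h := norm_mulVec_le_opNormR ((g⁻¹ : SpecialLinearGroup (Fin d) ℝ) : Matrix (Fin d) (Fin d) ℝ) ((g : Matrix (Fin d) (Fin d) ℝ) *ᵥ fun i => (z i : ℝ))
  have hinv : ((g⁻¹ : SpecialLinearGroup (Fin d) ℝ) : Matrix (Fin d) (Fin d) ℝ) *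
      (g : Matrix (Fin d) (Fin d) ℝ) = 1 := congrArg Subtype.val (inv_mul_cancel g)
  rw [mulVec_mulVec, hinv, one_mulVec, ← latticeMap_apply, ← hN] at h
  linarith [one_le_norm_intCast hz, norm_nonneg (latticeMap g z)]

theorem latticeMap_injective {d : ℕ} (g : SpecialLinearGroup (Fin d) ℝ) :
    Function.Injective (latticeMap g) := by
  obtain ⟨ε, hε, h⟩ := exists_le_norm_latticeMap g
  refine (injective_iff_map_eq_zero _).2 fun z hz => by_contra fun hz0 => ?_
  have := h z hz0
  rw [hz, norm_zero] at this
  linarith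

open MeasureTheory in
/-- Minkowski's theorem for a unimodular lattice, with a crude constant. -/
theorem exists_norm_latticeMap_le {d : ℕ} (hd : 0 < d) (g : SpecialLinearGroup (Fin d) ℝ) :
    ∃ z : Fin d → ℤ, z ≠ 0 ∧ ‖latticeMap g z‖ ≤ 2 * d := by
  set b : Basis (Fin d) ℝ (Fin d → ℝ) :=
    (Pi.basisFun ℝ (Fin d)).map (SpecialLinearGroup.toLin'_equiv g) with hb
  have hbi (i : Fin d) : b i = (g : Matrix (Fin d) (Fin d) ℝ)ᵀ i := by
    ext j
    change ((g : Matrix (Fin d) (Fin d) ℝ) *ᵥ Pi.basisFun ℝ (Fin d) i) j = _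
    simp
  have hvol : volume (ZSpan.fundamentalDomain b) = 1 := by
    have : Matrix.of b = (g : Matrix (Fin d) (Fin d) ℝ)ᵀ := by
      ext i j
      simp [hbi]
    rw [ZSpan.volume_fundamentalDomain, this, det_transpose, g.2]
    simp
  have hfund := ZSpan.isAddFundamentalDomain' b volume
  have : Countable (Submodule.span ℤ (Set.range b)).toAddSubgroup :=
    inferInstanceAs (Countable (Submodule.span ℤ (Set.range b)))
  obtain ⟨⟨x, hx⟩, hx0, hxs⟩ :=
    exists_ne_zero_mem_lattice_of_measure_mul_two_pow_lt_measure (s := Metric.ball 0 2) hfund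
      (by simp) (convex_ball _ _) (by
        rw [hvol, Real.volume_pi_ball _ (by norm_num), Fintype.card_fin, finrank_fin_fun, one_mul,
          ENNReal.ofReal_pow (by norm_num)]
        refine ENNReal.pow_lt_pow_left hd.ne' ?_
        rw [ENNReal.lt_ofReal_iff_toReal_lt (by simp)]
        norm_num)
  have hx' : x ∈ Submodule.span ℤ (Set.range b) := hx
  obtain ⟨c, hc⟩ := (Submodule.mem_span_range_iff_exists_fun ℤ).1 hx'
  have hcx : latticeMap g c = toLp 2 x := by
    rw [latticeMap_apply, ← hc]
    ext j
    simp [hbi, mulVec, dotProduct, mul_comm]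
  refine ⟨c, ?_, ?_⟩
  · rintro rfl
    apply hx0
    rw [map_zero] at hcx
    ext j
    simpa using (congrFun (congrArg ofLp hcx) j).symm
  · rw [hcx, EuclideanSpace.norm_eq]
    refine Real.sqrt_le_iff.2 ⟨by positivity, ?_⟩
    have h1 : ∀ i ∈ Finset.univ, ‖(toLp 2 x) i‖ ^ 2 ≤ (2 : ℝ) ^ 2 := fun i _ => by
      gcongr
      exact (norm_le_pi_norm x i).trans (mem_ball_zero_iff.1 hxs).le
    have h2 := Finset.sum_le_sum h1
    have h3 : (1 : ℝ) ≤ d := mod_cast hd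
    simp at h2 ⊢
    nlinarith

/-- Integer vectors spanning `ℤ^d` are, up to the sign of the first one, the columns of an element
of `SL_d(ℤ)`. -/
theorem exists_specialLinearGroup_of_span_eq_top {m : ℕ} (z : Fin (m + 1) → Fin (m + 1) → ℤ)
    (hz : Submodule.span ℤ (Set.range z) = ⊤) :
    ∃ δ : SpecialLinearGroup (Fin (m + 1)) ℤ, ∃ s : ℤ, s ^ 2 = 1 ∧
      ∀ i, (δ : Matrix (Fin (m + 1)) (Fin (m + 1)) ℤ)ᵀ i = if i = 0 then s • z 0 else z i := by
  set D : Matrix (Fin (m + 1)) (Fin (m + 1)) ℤ := (Matrix.of z)ᵀ with hD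
  have hcol (j : Fin (m + 1)) : ∃ c : Fin (m + 1) → ℤ, ∑ i, c i • z i = Pi.single j 1 :=
    (Submodule.mem_span_range_iff_exists_fun ℤ).1 (hz ▸ Submodule.mem_top)
  choose c hc using hcol
  have hDC : D * (Matrix.of c)ᵀ = 1 := by
    ext i j
    have := congrFun (hc j) i
    simp only [Finset.sum_apply, Pi.smul_apply, smul_eq_mul] at this
    simp only [mul_apply, hD, transpose_apply, of_apply, one_apply, mul_comm (z _ _), this,
      Pi.single_apply]
  have hdet : D.det ^ 2 = 1 := by
    rcases Int.isUnit_iff.1 (Matrix.isUnit_det_of_right_inverse hDC) with h | h <;> simp [h]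
  refine ⟨⟨D.updateCol 0 (D.det • z 0), ?_⟩, D.det, hdet, fun i => ?_⟩
  · have h0 : D.updateCol 0 (z 0) = D := updateCol_eq_self D 0
    rw [det_updateCol_smul, h0, ← sq, hdet]
  · ext j
    rw [transpose_apply]
    change D.updateCol 0 (D.det • z 0) j i = _
    by_cases hi : i = 0
    · simp [hi]
    · simp [hi, hD]

open scoped RealInnerProductSpace in
theorem exists_reduced_specialLinearGroup {m : ℕ} (hm : 1 ≤ m)
    (g : SpecialLinearGroup (Fin (m + 1)) ℝ) :
    ∃ δ : SpecialLinearGroup (Fin (m + 1)) ℤ, ∃ w : EuclideanSpace ℝ (Fin (m + 1)),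
      (∀ i, ⟪w, latticeMap g ((δ : Matrix (Fin (m + 1)) (Fin (m + 1)) ℤ)ᵀ i)⟫ =
        if i = Fin.last m then 1 else 0) ∧
      ‖latticeMap g ((δ : Matrix (Fin (m + 1)) (Fin (m + 1)) ℤ)ᵀ 0)‖ ≤ 4 * (m + 1) ∧
      ∀ i, ‖latticeMap g ((δ : Matrix (Fin (m + 1)) (Fin (m + 1)) ℤ)ᵀ i)‖ * ‖w‖ ≤ 2 ^ m := by
  set φ := latticeMap g with hφ
  have hinj : Function.Injective φ := latticeMap_injective g
  obtain ⟨ε, hε, hlow⟩ := exists_le_norm_latticeMap g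
  have hrank : finrank ℤ (LinearMap.range φ) = m + 1 := by
    rw [LinearMap.finrank_range_of_inj hinj, finrank_fin_fun]
  obtain ⟨b, hb, hb0, w, hw, hbw⟩ := exists_reduced_spanning_family m (LinearMap.range φ) hrank hε
    (by
      rintro _ ⟨z, rfl⟩ hz
      exact hlow z (by rintro rfl; simp at hz))
  have hbmem (i) : b i ∈ LinearMap.range φ := hb ▸ Submodule.subset_span (Set.mem_range_self i)
  choose z hz using hbmem
  have hspan : Submodule.span ℤ (Set.range z) = ⊤ := by
    apply Submodule.map_injective_of_injective hinj
    rw [Submodule.map_span, ← Set.range_comp, Submodule.map_top, ← hb]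
    congr 2
    exact funext hz
  obtain ⟨δ, s, hs, hδ⟩ := exists_specialLinearGroup_of_span_eq_top z hspan
  have hnorm (i) : ‖φ ((δ : Matrix (Fin (m + 1)) (Fin (m + 1)) ℤ)ᵀ i)‖ = ‖b i‖ := by
    rw [hδ]
    split_ifs with hi
    · rw [hi, map_smul, hz]
      rcases Int.isUnit_iff.1 (IsUnit.of_pow_eq_one hs two_ne_zero) with rfl | rfl <;> simp
    · rw [hz]
  refine ⟨δ, w, fun i => ?_, ?_, fun i => by rw [hnorm]; exact hbw i⟩
  · have h0 : (0 : Fin (m + 1)) ≠ Fin.last m := by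
      rw [Ne, Fin.ext_iff]
      simp
      omega
    rw [hδ]
    split_ifs with hi hi' hi'
    · exact absurd (hi.symm.trans hi') h0
    · rw [map_smul, hz, ← Int.cast_smul_eq_zsmul ℝ, inner_smul_right, hw, if_neg h0, mul_zero]
    · rw [hz, hw, if_pos hi']
    · rw [hz, hw, if_neg hi']
  · obtain ⟨y, hy0, hy⟩ := exists_norm_latticeMap_le (Nat.succ_pos m) g
    have := hb0 (φ y) ⟨y, rfl⟩ (by rwa [Ne, map_eq_zero_iff φ hinj])
    rw [hnorm]
    push_cast at hy
    linarith

theorem toLp_transpose_mul_intMat {d : ℕ} (g : SpecialLinearGroup (Fin d) ℝ)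
    (δ : SpecialLinearGroup (Fin d) ℤ) (i : Fin d) :
    toLp 2 (((g : Matrix (Fin d) (Fin d) ℝ) * intMat δ)ᵀ i) =
      latticeMap g ((δ : Matrix (Fin d) (Fin d) ℤ)ᵀ i) := rfl

theorem iInf_opNormR_pos {d : ℕ} (hd : 0 < d) (g : SpecialLinearGroup (Fin d) ℝ) :
    0 < ⨅ δ : SpecialLinearGroup (Fin d) ℤ,
      opNormR ((g : Matrix (Fin d) (Fin d) ℝ) * intMat δ) := by
  obtain ⟨ε, hε, hlow⟩ := exists_le_norm_latticeMap g
  refine hε.trans_le (le_ciInf fun δ => ?_)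
  have hcol : (δ : Matrix (Fin d) (Fin d) ℤ)ᵀ ⟨0, hd⟩ ≠ 0 := fun h => by
    have h0 : (δ : Matrix (Fin d) (Fin d) ℤ)ᵀ.det = 0 :=
      det_eq_zero_of_row_eq_zero ⟨0, hd⟩ fun j => congrFun h j
    rw [det_transpose, δ.2] at h0
    exact one_ne_zero h0
  have h := norm_mulVec_le_opNormR ((g : Matrix (Fin d) (Fin d) ℝ) * intMat δ)
    (Pi.single (⟨0, hd⟩ : Fin d) (1 : ℝ))
  rw [mulVec_single_one] at h
  have h1 : ‖toLp 2 (Pi.single ⟨0, hd⟩ 1 : Fin d → ℝ)‖ = 1 := by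
    simp
  rw [h1, mul_one] at h
  exact (hlow _ hcol).trans h

theorem intMat_mul {d : ℕ} (γ δ : SpecialLinearGroup (Fin d) ℤ) :
    intMat (γ * δ) = intMat γ * intMat δ :=
  Matrix.map_mul (f := Int.castRingHom ℝ)

theorem intMat_one {d : ℕ} : intMat (1 : SpecialLinearGroup (Fin d) ℤ) = 1 :=
  Matrix.map_one _ Int.cast_zero Int.cast_one

/-- The conjugate by `g` of the transvection in the basis `δ` differs from the identity by the
rank one matrix `v wᵀ`, where `v` is a column of `g δ` and `w` a row of its inverse. -/
theorem opNormR_conj_transvection_sub_one_le {d : ℕ} (g : SpecialLinearGroup (Fin d) ℝ)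
    (δ : SpecialLinearGroup (Fin d) ℤ) {i j : Fin d} (hij : i ≠ j) (w : Fin d → ℝ)
    (hw : w ᵥ* ((g : Matrix (Fin d) (Fin d) ℝ) * intMat δ) = Pi.single j 1) :
    opNormR ((g : Matrix (Fin d) (Fin d) ℝ) *
        intMat (δ * SpecialLinearGroup.transvection hij 1 * δ⁻¹) *
        ((g⁻¹ : SpecialLinearGroup (Fin d) ℝ) : Matrix (Fin d) (Fin d) ℝ) - 1) ≤
      ‖latticeMap g ((δ : Matrix (Fin d) (Fin d) ℤ)ᵀ i)‖ * ‖toLp 2 w‖ := by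
  set G : Matrix (Fin d) (Fin d) ℝ := g.1
  set N : Matrix (Fin d) (Fin d) ℝ := (g⁻¹).1
  have hGN : G * N = 1 := congrArg Subtype.val (mul_inv_cancel g)
  have hδ : intMat δ * intMat δ⁻¹ = 1 := by rw [← intMat_mul, mul_inv_cancel, intMat_one]
  have ht : intMat (SpecialLinearGroup.transvection hij (1 : ℤ)) = 1 + single i j 1 := by
    change (1 + single i j (1 : ℤ)).map (Int.castRingHom ℝ) = _
    rw [Matrix.map_add _ (map_add _), Matrix.map_one _ (map_zero _) (map_one _),
      Matrix.map_single, map_one]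
  have hinv : (G * intMat δ) * (intMat δ⁻¹ * N) = 1 := by
    rw [Matrix.mul_assoc, ← Matrix.mul_assoc (intMat δ), hδ, Matrix.one_mul, hGN]
  have hrow : Pi.single j 1 ᵥ* (intMat δ⁻¹ * N) = w := by
    rw [← hw, vecMul_vecMul, hinv, vecMul_one]
  have hkey : G * intMat (δ * SpecialLinearGroup.transvection hij 1 * δ⁻¹) * N - 1 =
      vecMulVec ((G * intMat δ)ᵀ i) w := by
    calc G * intMat (δ * SpecialLinearGroup.transvection hij 1 * δ⁻¹) * N - 1
        = (G * intMat δ) * (1 + single i j 1) * (intMat δ⁻¹ * N) - 1 := by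
          rw [intMat_mul, intMat_mul, ht]
          simp only [Matrix.mul_assoc]
      _ = (G * intMat δ) * single i j 1 * (intMat δ⁻¹ * N) := by
          rw [Matrix.mul_add, Matrix.mul_one, Matrix.add_mul, hinv, add_sub_cancel_left]
      _ = _ := by
          rw [single_eq_single_vecMulVec_single, mul_vecMulVec, vecMulVec_mul, hrow,
            mulVec_single_one]
          rfl
  rw [hkey]
  exact opNormR_vecMulVec_le _ _

theorem conj_transvection_sub_one_pow {d : ℕ} (hd : 2 ≤ d) (δ : SpecialLinearGroup (Fin d) ℤ)
    {i j : Fin d} (hij : i ≠ j) :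
    (((δ * SpecialLinearGroup.transvection hij 1 * δ⁻¹ : SpecialLinearGroup (Fin d) ℤ) :
      Matrix (Fin d) (Fin d) ℤ) - 1) ^ d = 0 := by
  set D : Matrix (Fin d) (Fin d) ℤ := δ.1
  set C : Matrix (Fin d) (Fin d) ℤ := (δ⁻¹).1
  have hDC : D * C = 1 := congrArg Subtype.val (mul_inv_cancel δ)
  have hCD : C * D = 1 := congrArg Subtype.val (inv_mul_cancel δ)
  have h : ((δ * SpecialLinearGroup.transvection hij 1 * δ⁻¹ : SpecialLinearGroup (Fin d) ℤ) :
      Matrix (Fin d) (Fin d) ℤ) - 1 = D * single i j 1 * C := by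
    change D * (1 + single i j 1) * C - 1 = _
    rw [Matrix.mul_add, Matrix.mul_one, Matrix.add_mul, hDC, add_sub_cancel_left]
  apply pow_eq_zero_of_le hd
  rw [h, sq]
  calc D * single i j 1 * C * (D * single i j 1 * C)
      = D * (single i j 1 * (C * D) * single i j 1) * C := by simp only [Matrix.mul_assoc]
    _ = 0 := by
      rw [hCD, Matrix.mul_one]
      simp [hij.symm]

theorem conj_transvection_ne_one {d : ℕ} (δ : SpecialLinearGroup (Fin d) ℤ)
    {i j : Fin d} (hij : i ≠ j) :
    δ * SpecialLinearGroup.transvection hij 1 * δ⁻¹ ≠ 1 := by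
  rw [Ne, conj_eq_one_iff]
  intro h
  have h1 : (1 + single i j 1 : Matrix (Fin d) (Fin d) ℤ) = 1 := congrArg Subtype.val h
  have := congrFun (congrFun h1 i) j
  simp [hij] at this

end

theorem stmt13 {d : ℕ} (hd : 2 ≤ d) :
    ∃ k : ℝ, 0 < k ∧ ∃ l : ℝ, 0 < l ∧
      ∀ g : Matrix.SpecialLinearGroup (Fin d) ℝ,
        ∃ γ : Matrix.SpecialLinearGroup (Fin d) ℤ, γ ≠ 1 ∧
          ((γ : Matrix (Fin d) (Fin d) ℤ) - 1) ^ d = 0 ∧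
          opNormR ((g : Matrix (Fin d) (Fin d) ℝ) * intMat γ *
              ((g⁻¹ : Matrix.SpecialLinearGroup (Fin d) ℝ) : Matrix (Fin d) (Fin d) ℝ) - 1) ≤
            l * (⨅ δ : Matrix.SpecialLinearGroup (Fin d) ℤ,
                opNormR ((g : Matrix (Fin d) (Fin d) ℝ) * intMat δ)) ^ (-k) := by
  obtain ⟨m, rfl⟩ : ∃ m, d = m + 1 := ⟨d - 1, by omega⟩
  have hij : (0 : Fin (m + 1)) ≠ Fin.last m := by
    rw [Ne, Fin.ext_iff, Fin.val_zero, Fin.val_last]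
    omega
  refine ⟨1, one_pos, 4 * (m + 1) * ((m + 1) * 2 ^ m), by positivity, fun g => ?_⟩
  obtain ⟨δ, w, hw, h0, hδ⟩ := exists_reduced_specialLinearGroup (by omega) g
  refine ⟨δ * Matrix.SpecialLinearGroup.transvection hij 1 * δ⁻¹, conj_transvection_ne_one δ hij,
    conj_transvection_sub_one_pow hd δ hij, ?_⟩
  refine (opNormR_conj_transvection_sub_one_le g δ hij w.ofLp ?_).trans ?_
  · ext i
    have := hw i
    rw [← toLp_transpose_mul_intMat, ← WithLp.toLp_ofLp 2 w, EuclideanSpace.inner_toLp_toLp,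
      star_trivial, dotProduct_comm] at this
    rw [Pi.single_apply]
    exact this
  · have hpos := iInf_opNormR_pos (Nat.succ_pos m) g
    set R := ⨅ δ : Matrix.SpecialLinearGroup (Fin (m + 1)) ℤ,
      opNormR ((g : Matrix (Fin (m + 1)) (Fin (m + 1)) ℝ) * intMat δ)
    have hRle : R ≤ opNormR ((g : Matrix (Fin (m + 1)) (Fin (m + 1)) ℝ) * intMat δ) :=
      ciInf_le ⟨0, by rintro _ ⟨δ, rfl⟩; exact opNormR_nonneg _⟩ δ
    have hRw : R * ‖w‖ ≤ (m + 1) * 2 ^ m := by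
      refine (mul_le_mul_of_nonneg_right (hRle.trans (opNormR_le_sum_norm_col _))
        (norm_nonneg w)).trans ?_
      rw [Finset.sum_mul]
      refine (Finset.sum_le_sum fun i _ => hδ i).trans ?_
      simp
    rw [Real.rpow_neg_one, ← div_eq_mul_inv, le_div_iff₀ hpos, mul_assoc]
    refine mul_le_mul h0 ?_ (by positivity) (by positivity)
    rwa [WithLp.toLp_ofLp, mul_comm]
end

section
/- For every d ≥ 2 there exists a constant r' ∈ ℕ (depending only on d) such that for every finite subset Σ ⊆ SL_d(ℤ) with 1 ∈ Σ generating a subgroup that is Zariski dense in SL_d, there exists h ∈ SL_d(ℝ) with max_{σ ∈ Σ} ‖h σ h⁻¹‖ ≤ max_{a ∈ Σ^{r'}} Λ(a), where Λ(a) denotes the spectral radius of a. -/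
open scoped Pointwise

/-- The spectral radius (maximal absolute value of the complex eigenvalues) of an
integer matrix. -/
noncomputable def LamZ {d : ℕ} (a : Matrix.SpecialLinearGroup (Fin d) ℤ) : ℝ :=
  (spectralRadius ℂ ((a : Matrix (Fin d) (Fin d) ℤ).map ((↑) : ℤ → ℂ))).toReal

section Escape

variable {G K : Type*} [Field K]

/-- The functions in `W` vanishing on `T`. -/
def vanishingIn (W : Submodule K (G → K)) (T : Set G) : Submodule K (G → K) where
  carrier := {f | f ∈ W ∧ ∀ a ∈ T, f a = 0}
  add_mem' := fun hf hg => ⟨W.add_mem hf.1 hg.1, fun a ha => by simp [hf.2 a ha, hg.2 a ha]⟩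
  zero_mem' := ⟨W.zero_mem, fun _ _ => rfl⟩
  smul_mem' := fun c f hf => ⟨W.smul_mem c hf.1, fun a ha => by simp [hf.2 a ha]⟩

lemma vanishingIn_le (W : Submodule K (G → K)) (T : Set G) : vanishingIn W T ≤ W :=
  fun _ hf => hf.1

lemma vanishingIn_anti (W : Submodule K (G → K)) {T T' : Set G} (h : T ⊆ T') :
    vanishingIn W T' ≤ vanishingIn W T :=
  fun _ hf => ⟨hf.1, fun a ha => hf.2 a (h ha)⟩

/-- A linear equivalence of a vector space mapping a finite-dimensional subspace into itself maps
it onto itself. -/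
lemma Submodule.symm_mem_of_map_le {V : Type*} [AddCommGroup V] [Module K V] (e : V ≃ₗ[K] V)
    (P : Submodule K V) [FiniteDimensional K P] (h : ∀ f ∈ P, e f ∈ P) {f : V} (hf : f ∈ P) :
    e.symm f ∈ P := by
  have hle : P.map (e : V →ₗ[K] V) ≤ P := by
    rintro _ ⟨x, hx, rfl⟩
    exact h x hx
  have heq : P.map (e : V →ₗ[K] V) = P :=
    Submodule.eq_of_le_of_finrank_eq hle (LinearEquiv.finrank_map_eq e P)
  rw [← heq] at hf
  obtain ⟨x, hx, rfl⟩ := hf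
  simpa using hx

/-- Escape from subvarieties: a function in a translation-invariant space `W` of finite dimension
that vanishes on `S ^ dim W` vanishes on the subgroup generated by `S`. -/
theorem eq_zero_on_closure_of_eq_zero_on_pow [Group G] (W : Submodule K (G → K))
    [FiniteDimensional K W]
    (hW : ∀ g : G, ∀ f ∈ W, (fun x => f (g * x)) ∈ W) {S : Set G} (h1 : (1 : G) ∈ S)
    {f : G → K} (hfW : f ∈ W) (hf : ∀ a ∈ S ^ Module.finrank K W, f a = 0) :
    ∀ a ∈ Subgroup.closure S, f a = 0 := by
  have hmono : ∀ {m n : ℕ}, m ≤ n → S ^ m ⊆ S ^ n := fun h => Set.pow_subset_pow_right h1 h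
  let P : ℕ → Submodule K (G → K) := fun n => vanishingIn W (S ^ n)
  have hfin : ∀ n, FiniteDimensional K (P n) := fun n =>
    Submodule.finiteDimensional_of_le (vanishingIn_le W _)
  obtain ⟨n, hn, hPn⟩ : ∃ n ≤ Module.finrank K W, P n = P (n + 1) := by
    by_contra! hne
    have key : ∀ n ≤ Module.finrank K W + 1, Module.finrank K (P n) + n ≤ Module.finrank K W := by
      intro n
      induction n with
      | zero => exact fun _ => Submodule.finrank_mono (vanishingIn_le W _)
      | succ k ih =>
        intro hk
        have hlt : P (k + 1) < P k :=
          lt_of_le_of_ne (vanishingIn_anti W (hmono k.le_succ)) (hne k (by omega)).symm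
        have := Submodule.finrank_lt_finrank_of_lt hlt
        have := ih (by omega)
        omega
    have := key _ le_rfl
    omega
  let T : G → ((G → K) ≃ₗ[K] (G → K)) := fun g => LinearEquiv.funCongrLeft K K (Equiv.mulLeft g)
  have hT : ∀ g f x, T g f x = f (g * x) := fun g f x => rfl
  have hTs : ∀ g f, (T g).symm f = T g⁻¹ f := by
    intro g f
    rw [LinearEquiv.symm_apply_eq]
    ext x
    simp [hT]
  have hstab : ∀ g ∈ Subgroup.closure S, ∀ f ∈ P n, T g f ∈ P n := by
    intro g hg
    induction hg using Subgroup.closure_induction with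
    | mem s hs =>
      intro f hf
      rw [hPn] at hf
      refine ⟨hW s f hf.1, fun a ha => hf.2 _ ?_⟩
      rw [pow_succ']
      exact Set.mul_mem_mul hs ha
    | one =>
      intro f hf
      convert hf using 1
      ext x
      simp [hT]
    | mul g h _ _ ihg ihh =>
      intro f hf
      convert ihh _ (ihg f hf) using 1
      ext x
      simp [hT, mul_assoc]
    | inv g _ ih =>
      intro f hf
      rw [← hTs]
      exact Submodule.symm_mem_of_map_le (T g) (P n) ih hf
  intro a ha
  have hfP : f ∈ P n := ⟨hfW, fun b hb => hf b (hmono hn hb)⟩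
  have := (hstab a ha f hfP).2 1 (Set.one_mem_pow h1)
  simpa [hT] using this

end Escape

section SpectralRadius

variable {d : ℕ}

lemma spectralRadius_ne_top (A : Matrix (Fin d) (Fin d) ℂ) :
    spectralRadius ℂ A ≠ ⊤ := by
  have hf := A.finite_spectrum
  have : spectralRadius ℂ A ≤ ∑ k ∈ hf.toFinset, ‖k‖ₑ := by
    refine iSup₂_le fun k hk => ?_
    exact Finset.single_le_sum (f := fun k : ℂ => ‖k‖ₑ) (fun _ _ => by positivity)
      (hf.mem_toFinset.2 hk)
  refine ne_top_of_le_ne_top ?_ this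
  simp [ENNReal.sum_eq_top]

lemma norm_le_toReal_spectralRadius {A : Matrix (Fin d) (Fin d) ℂ} {k : ℂ}
    (hk : k ∈ spectrum ℂ A) : ‖k‖ ≤ (spectralRadius ℂ A).toReal := by
  have h : ‖k‖ₑ ≤ spectralRadius ℂ A := le_iSup₂ (f := fun (k : ℂ) _ => ‖k‖ₑ) k hk
  simpa using ENNReal.toReal_mono (spectralRadius_ne_top A) h

lemma exists_norm_eq_toReal_spectralRadius (hd : 0 < d) (A : Matrix (Fin d) (Fin d) ℂ) :
    ∃ k ∈ spectrum ℂ A, ‖k‖ = (spectralRadius ℂ A).toReal := by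
  have : NeZero d := ⟨hd.ne'⟩
  have hne : (spectrum ℂ A).Nonempty :=
    spectrum.nonempty_of_isAlgClosed_of_finiteDimensional ℂ A
  obtain ⟨k, hk, hmax⟩ := Set.exists_max_image _ (fun k : ℂ => ‖k‖ₑ) A.finite_spectrum hne
  refine ⟨k, hk, le_antisymm (norm_le_toReal_spectralRadius hk) ?_⟩
  have h : spectralRadius ℂ A ≤ ‖k‖ₑ := iSup₂_le hmax
  simpa using ENNReal.toReal_mono (by simp) h

lemma norm_trace_le_spectralRadius (A : Matrix (Fin d) (Fin d) ℂ) :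
    ‖A.trace‖ ≤ d * (spectralRadius ℂ A).toReal := by
  rw [Matrix.trace_eq_sum_roots_charpoly]
  have hcard : A.charpoly.roots.card ≤ d := by
    simpa using A.charpoly.card_roots'
  have h : ‖A.charpoly.roots.sum‖ ≤
      (A.charpoly.roots.map (fun k => ‖k‖)).sum := norm_multiset_sum_le _
  refine h.trans ((Multiset.sum_le_card_nsmul _ (spectralRadius ℂ A).toReal ?_).trans ?_)
  · intro x hx
    obtain ⟨k, hk, rfl⟩ := Multiset.mem_map.1 hx
    exact norm_le_toReal_spectralRadius
      (Matrix.mem_spectrum_of_isRoot_charpoly (Polynomial.isRoot_of_mem_roots hk))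
  · rw [nsmul_eq_mul, Multiset.card_map]
    gcongr

lemma abs_trace_le_LamZ (a : Matrix.SpecialLinearGroup (Fin d) ℤ) :
    |((a : Matrix (Fin d) (Fin d) ℤ).trace : ℝ)| ≤ d * LamZ a := by
  have h := norm_trace_le_spectralRadius ((a : Matrix (Fin d) (Fin d) ℤ).map ((↑) : ℤ → ℂ))
  have htr : ((a : Matrix (Fin d) (Fin d) ℤ).map ((↑) : ℤ → ℂ)).trace =
      (((a : Matrix (Fin d) (Fin d) ℤ).trace : ℤ) : ℂ) := by
    simp [Matrix.trace]
  rw [htr, Complex.norm_intCast] at h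
  exact h

lemma LamZ_pow_le (hd : 0 < d) (a : Matrix.SpecialLinearGroup (Fin d) ℤ) (n : ℕ) :
    LamZ a ^ n ≤ LamZ (a ^ n) := by
  obtain ⟨k, hk, hnorm⟩ := exists_norm_eq_toReal_spectralRadius hd
    ((a : Matrix (Fin d) (Fin d) ℤ).map ((↑) : ℤ → ℂ))
  have hpow : ((a ^ n : Matrix.SpecialLinearGroup (Fin d) ℤ) : Matrix (Fin d) (Fin d) ℤ).map
      ((↑) : ℤ → ℂ) = ((a : Matrix (Fin d) (Fin d) ℤ).map ((↑) : ℤ → ℂ)) ^ n := by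
    rw [Matrix.SpecialLinearGroup.coe_pow]
    exact map_pow (Int.castRingHom ℂ).mapMatrix _ n
  unfold LamZ
  rw [hpow, ← hnorm, ← norm_pow]
  exact norm_le_toReal_spectralRadius (spectrum.pow_mem_pow _ n hk)

end SpectralRadius

section Norm

variable {d : ℕ}

lemma opNormR_le_sum (A : Matrix (Fin d) (Fin d) ℝ) : opNormR A ≤ ∑ i, ∑ j, |A i j| := by
  refine ContinuousLinearMap.opNorm_le_bound _ (by positivity) fun x => ?_
  have hy : ∀ y : EuclideanSpace ℝ (Fin d), ‖y‖ ≤ ∑ i, |y i| := by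
    intro y
    rw [EuclideanSpace.norm_eq]
    refine Real.sqrt_le_iff.2 ⟨by positivity, ?_⟩
    simpa using Finset.sum_sq_le_sq_sum_of_nonneg (s := Finset.univ) (f := fun i => |y i|)
      (fun _ _ => abs_nonneg _)
  refine (hy _).trans ?_
  rw [Finset.sum_mul]
  refine Finset.sum_le_sum fun i _ => ?_
  have : (LinearMap.toContinuousLinearMap (Matrix.toEuclideanLin A) x) i = ∑ j, A i j * x j := rfl
  rw [this, Finset.sum_mul]
  refine (Finset.abs_sum_le_sum_abs _ _).trans (Finset.sum_le_sum fun j _ => ?_)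
  rw [abs_mul]
  gcongr
  exact PiLp.norm_apply_le x j

end Norm

section Zariski

variable {d : ℕ}

/-- An integral unimodular matrix, with its entries viewed in a ring `R`. -/
def castMat (R : Type*) [CommRing R] (γ : Matrix.SpecialLinearGroup (Fin d) ℤ) :
    Matrix (Fin d) (Fin d) R :=
  (Int.castRingHom R).mapMatrix (γ : Matrix (Fin d) (Fin d) ℤ)

@[simp]
lemma castMat_apply (R : Type*) [CommRing R] (γ : Matrix.SpecialLinearGroup (Fin d) ℤ)
    (i j : Fin d) : castMat R γ i j = ((γ : Matrix (Fin d) (Fin d) ℤ) i j : R) :=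
  rfl

@[simp]
lemma castMat_mul (R : Type*) [CommRing R] (γ δ : Matrix.SpecialLinearGroup (Fin d) ℤ) :
    castMat R (γ * δ) = castMat R γ * castMat R δ := by
  rw [castMat, Matrix.SpecialLinearGroup.coe_mul, map_mul]
  rfl

lemma trace_castMat (R : Type*) [CommRing R] (γ : Matrix.SpecialLinearGroup (Fin d) ℤ) :
    (castMat R γ).trace = ((γ : Matrix (Fin d) (Fin d) ℤ).trace : R) := by
  simp [Matrix.trace]

/-- The functions on `SL_d(ℤ)` given by rational polynomials of degree at most one in the
entries. -/
def affineFunctions (d : ℕ) : Submodule ℚ (Matrix.SpecialLinearGroup (Fin d) ℤ → ℚ) :=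
  Submodule.span ℚ (insert 1 (Set.range fun ij : Fin d × Fin d => fun γ => castMat ℚ γ ij.1 ij.2))

lemma one_le_affineFunctions : 1 ≤ affineFunctions d :=
  Submodule.one_le.2 (Submodule.subset_span (Set.mem_insert _ _))

lemma const_mem_affineFunctions (c : ℚ) :
    (fun _ => c) ∈ affineFunctions d := by
  have : (1 : Matrix.SpecialLinearGroup (Fin d) ℤ → ℚ) ∈ affineFunctions d :=
    Submodule.subset_span (Set.mem_insert _ _)
  convert (affineFunctions d).smul_mem c this using 1
  ext
  simp

lemma linearMap_castMat_mem_affineFunctions (φ : Matrix (Fin d) (Fin d) ℚ →ₗ[ℚ] ℚ) :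
    (fun γ => φ (castMat ℚ γ)) ∈ affineFunctions d := by
  have : (fun γ => φ (castMat ℚ γ)) = ∑ i, ∑ j, φ (Matrix.single i j 1) •
      fun γ : Matrix.SpecialLinearGroup (Fin d) ℤ => castMat ℚ γ i j := by
    ext γ
    conv_lhs => rw [Matrix.matrix_eq_sum_single (castMat ℚ γ)]
    simp only [map_sum, Finset.sum_apply, Pi.smul_apply, smul_eq_mul]
    refine Finset.sum_congr rfl fun i _ => Finset.sum_congr rfl fun j _ => ?_
    rw [← mul_one (castMat ℚ γ i j), ← smul_eq_mul, ← Matrix.smul_single, map_smul]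
    simp [mul_comm]
  rw [this]
  exact Submodule.sum_mem _ fun i _ => Submodule.sum_mem _ fun j _ => Submodule.smul_mem _ _
    (Submodule.subset_span (Set.mem_insert_of_mem _ ⟨(i, j), rfl⟩))

lemma affineFunctions_translate (g : Matrix.SpecialLinearGroup (Fin d) ℤ) (D : ℕ)
    {f : Matrix.SpecialLinearGroup (Fin d) ℤ → ℚ} (hf : f ∈ affineFunctions d ^ D) :
    (fun x => f (g * x)) ∈ affineFunctions d ^ D := by
  let T : (Matrix.SpecialLinearGroup (Fin d) ℤ → ℚ) →ₐ[ℚ]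
      (Matrix.SpecialLinearGroup (Fin d) ℤ → ℚ) :=
    AlgHom.pi fun x => Pi.evalAlgHom ℚ _ (g * x)
  have hT : ∀ f x, T f x = f (g * x) := fun f x => rfl
  have hmap : (affineFunctions d).map T.toLinearMap ≤ affineFunctions d := by
    conv_lhs => rw [affineFunctions]
    rw [Submodule.map_span_le]
    rintro f (rfl | ⟨⟨i, j⟩, rfl⟩)
    · convert const_mem_affineFunctions 1 using 1
      exact map_one T
    · have := linearMap_castMat_mem_affineFunctions
        (Matrix.entryLinearMap ℚ ℚ i j ∘ₗ LinearMap.mulLeft ℚ (castMat ℚ g))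
      convert this using 1
      ext x
      simp only [AlgHom.toLinearMap_apply, hT, castMat_mul]
      rfl
  have : T f ∈ (affineFunctions d).map T.toLinearMap ^ D := by
    rw [← Submodule.map_pow]
    exact ⟨f, hf, rfl⟩
  exact pow_le_pow_left' hmap D this

/-- Uniform escape: a function of degree at most `D` vanishing on a fixed power of a generating set
vanishes on the generated group. -/
lemma exists_pow_escape (d D : ℕ) : ∃ N : ℕ, ∀ S : Set (Matrix.SpecialLinearGroup (Fin d) ℤ),
    1 ∈ S → ∀ f ∈ affineFunctions d ^ D, (∀ a ∈ S ^ N, f a = 0) →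
      ∀ a ∈ Subgroup.closure S, f a = 0 := by
  have hfg : (affineFunctions d ^ D).FG := by
    refine Submodule.FG.pow ?_ D
    exact Submodule.fg_span ((Set.finite_range _).insert 1)
  have : FiniteDimensional ℚ ↥(affineFunctions d ^ D) := Module.Finite.iff_fg.2 hfg
  exact ⟨_, fun S h1 f hfW hf => eq_zero_on_closure_of_eq_zero_on_pow (affineFunctions d ^ D)
    (fun g f hf => affineFunctions_translate g D hf) h1 hfW hf⟩

lemma linearMap_eq_zero_of_forall_specialLinearGroup (hd : 2 ≤ d)
    (L : Matrix (Fin d) (Fin d) ℂ →ₗ[ℂ] ℂ)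
    (hL : ∀ g : Matrix.SpecialLinearGroup (Fin d) ℂ, L g = 0) : L = 0 := by
  have h1 : L 1 = 0 := by simpa using hL 1
  have hoff : ∀ i j, i ≠ j → L (Matrix.single i j 1) = 0 := by
    intro i j hij
    have := hL ⟨Matrix.transvection i j 1, Matrix.det_transvection_of_ne i j hij 1⟩
    simpa [Matrix.transvection, h1] using this
  have hdiag : ∀ i, L (Matrix.single i i 1) = 0 := by
    intro i
    obtain ⟨j, hj⟩ : ∃ j : Fin d, j ≠ i := by
      have : Nontrivial (Fin d) := Fin.nontrivial_iff_two_le.2 hd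
      exact exists_ne i
    have := hL ⟨Matrix.transvection i j 1 * Matrix.transvection j i 1, by
      rw [Matrix.det_mul, Matrix.det_transvection_of_ne i j hj.symm,
        Matrix.det_transvection_of_ne j i hj, mul_one]⟩
    simpa [Matrix.transvection, h1, mul_add, add_mul, hoff i j hj.symm, hoff j i hj] using this
  refine Matrix.ext_linearMap _ fun i j => LinearMap.ext_ring ?_
  by_cases hij : i = j
  · subst hij
    simpa using hdiag i
  · simpa using hoff i j hij

lemma linearMap_eq_zero_of_zariskiDense (hd : 2 ≤ d)
    {Δ : Subgroup (Matrix.SpecialLinearGroup (Fin d) ℤ)} (hΔ : ZariskiDenseSLZ d Δ)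
    (φ : Matrix (Fin d) (Fin d) ℚ →ₗ[ℚ] ℚ) (hφ : ∀ γ ∈ Δ, φ (castMat ℚ γ) = 0) : φ = 0 := by
  let p : MvPolynomial (Fin d × Fin d) ℚ :=
    ∑ i, ∑ j, MvPolynomial.C (φ (Matrix.single i j 1)) * MvPolynomial.X (i, j)
  let L : Matrix (Fin d) (Fin d) ℂ →ₗ[ℂ] ℂ :=
    ∑ i, ∑ j, (φ (Matrix.single i j 1) : ℂ) • Matrix.entryLinearMap ℂ ℂ i j
  have hp := hΔ p fun γ hγ => by
    rw [← hφ γ hγ]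
    conv_rhs => rw [Matrix.matrix_eq_sum_single (castMat ℚ γ)]
    simp only [p, map_sum, map_mul, MvPolynomial.aeval_C, MvPolynomial.aeval_X]
    refine Finset.sum_congr rfl fun i _ => Finset.sum_congr rfl fun j _ => ?_
    rw [← mul_one (castMat ℚ γ i j), ← smul_eq_mul (castMat ℚ γ i j), ← Matrix.smul_single,
      map_smul]
    simp [mul_comm]
  have hL : L = 0 := linearMap_eq_zero_of_forall_specialLinearGroup hd L fun g => by
    have := hp g
    simpa [p, L] using this
  refine Matrix.ext_linearMap _ fun i j => LinearMap.ext_ring ?_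
  have h := congrArg (fun L => L (Matrix.single i j 1)) hL
  simp only [L, LinearMap.sum_apply, LinearMap.smul_apply, Matrix.entryLinearMap_apply,
    LinearMap.zero_apply] at h
  rw [Finset.sum_eq_single i (fun k _ hk => Finset.sum_eq_zero fun l _ => by
      simp [hk.symm]) (by simp),
    Finset.sum_eq_single j (fun l _ hl => by simp [hl.symm]) (by simp)] at h
  simpa using h

lemma exists_trace_of_zariskiDense (hd : 2 ≤ d)
    {Δ : Subgroup (Matrix.SpecialLinearGroup (Fin d) ℤ)} (hΔ : ZariskiDenseSLZ d Δ)
    (s : Finset ℤ) (hs : ∀ n ∈ s, n ≤ 2 * d) :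
    ∃ γ ∈ Δ, ∏ n ∈ s, ((castMat ℚ γ).trace - n) ≠ 0 := by
  by_contra! hzero
  let p : MvPolynomial (Fin d × Fin d) ℚ :=
    ∏ n ∈ s, (∑ i, MvPolynomial.X (i, i) - MvPolynomial.C (n : ℚ))
  have hp := hΔ p fun γ hγ => by
    rw [← hzero γ hγ]
    simp [p, Matrix.trace]
  let i : Fin d := ⟨0, by omega⟩
  let j : Fin d := ⟨1, by omega⟩
  have hij : i ≠ j := by simp [i, j]
  let t : ℂ := 2 * d + 1
  have h := hp ⟨Matrix.transvection i j t * Matrix.transvection j i 1, by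
      rw [Matrix.det_mul, Matrix.det_transvection_of_ne i j hij,
        Matrix.det_transvection_of_ne j i hij.symm, mul_one]⟩
  have htr : (Matrix.transvection i j t * Matrix.transvection j i (1 : ℂ)).trace = d + t := by
    simp [Matrix.transvection, mul_add, add_mul, Matrix.trace_add, Matrix.trace_single_eq_of_ne,
      hij, hij.symm]
  simp only [p, map_prod, map_sub, map_sum, MvPolynomial.aeval_X, MvPolynomial.aeval_C,
    Finset.prod_eq_zero_iff] at h
  obtain ⟨n, hn, hne⟩ := h
  have h2 : (d : ℂ) + t - n = 0 := by
    rw [← htr, ← hne]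
    simp [Matrix.trace]
  have h3 : (d : ℤ) + (2 * d + 1) - n = 0 := by
    simp only [t] at h2
    exact_mod_cast h2
  have := hs n hn
  omega

end Zariski

section LinearAlgebra

open scoped Matrix

lemma exists_fun_fin_of_span_eq_top {K V : Type*} [Field K] [AddCommGroup V] [Module K V]
    [FiniteDimensional K V] {s : Set V} (hs : Submodule.span K s = ⊤) :
    ∃ f : Fin (Module.finrank K V) → V, (∀ i, f i ∈ s) ∧
      Submodule.span K (Set.range f) = ⊤ ∧ LinearIndependent K f := by
  have h := Submodule.exists_fun_fin_finrank_span_eq K s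
  rwa [hs, finrank_top] at h

variable {d : ℕ}

lemma det_trace_mul_ne_zero {ι : Type*} [Fintype ι] [DecidableEq ι]
    (b : ι → Matrix (Fin d) (Fin d) ℚ) (hspan : Submodule.span ℚ (Set.range b) = ⊤)
    (hli : LinearIndependent ℚ b) : (Matrix.of fun i j => (b i * b j).trace).det ≠ 0 := by
  intro hdet
  obtain ⟨v, hv, hv0⟩ := Matrix.exists_mulVec_eq_zero_iff.2 hdet
  have hx : ∀ i, (b i * ∑ j, v j • b j).trace = 0 := fun i => by
    have := congrFun hv0 i
    simpa [Matrix.mulVec, dotProduct, Finset.mul_sum, Matrix.trace_sum, mul_comm] using this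
  have hzero : ∑ j, v j • b j = 0 := by
    rw [Matrix.ext_iff_trace_mul_left]
    intro y
    obtain ⟨c, rfl⟩ := (Submodule.mem_span_range_iff_exists_fun ℚ).1
      (hspan ▸ Submodule.mem_top : y ∈ Submodule.span ℚ (Set.range b))
    rw [Finset.sum_mul, Matrix.trace_sum]
    simp only [Matrix.smul_mul, Matrix.trace_smul, hx]
    simp
  exact hv (funext (Fintype.linearIndependent_iff.1 hli v hzero))

/-- In a basis consisting of integral matrices, the coordinates of left multiplication by an
integral matrix are polynomially bounded in terms of traces. -/
lemma exists_coeff_bound {n : ℕ} (b : Fin n → Matrix.SpecialLinearGroup (Fin d) ℤ)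
    (hspan : Submodule.span ℚ (Set.range fun i => castMat ℚ (b i)) = ⊤)
    (hli : LinearIndependent ℚ fun i => castMat ℚ (b i))
    (σ : Matrix.SpecialLinearGroup (Fin d) ℤ) {B : ℝ}
    (hG : ∀ i j, |((b i * b j : Matrix.SpecialLinearGroup (Fin d) ℤ).1.trace : ℝ)| ≤ B)
    (hT : ∀ i j, |((b i * (σ * b j) : Matrix.SpecialLinearGroup (Fin d) ℤ).1.trace : ℝ)| ≤ B)
    (j : Fin n) :
    ∃ c : Fin n → ℚ, castMat ℚ σ * castMat ℚ (b j) = ∑ i, c i • castMat ℚ (b i) ∧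
      ∀ i, |(c i : ℝ)| ≤ n.factorial * B ^ n := by
  obtain ⟨c, hc⟩ := (Submodule.mem_span_range_iff_exists_fun ℚ).1
    (hspan ▸ Submodule.mem_top : castMat ℚ σ * castMat ℚ (b j) ∈
      Submodule.span ℚ (Set.range fun i => castMat ℚ (b i)))
  refine ⟨c, hc.symm, fun i => ?_⟩
  let G : Matrix (Fin n) (Fin n) ℤ := Matrix.of fun i j => (b i * b j).1.trace
  let T : Fin n → ℤ := fun i => (b i * (σ * b j)).1.trace
  let H : Matrix (Fin n) (Fin n) ℤ := G.updateCol i T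
  have hGmap : (Int.castRingHom ℚ).mapMatrix G =
      Matrix.of fun i j => (castMat ℚ (b i) * castMat ℚ (b j)).trace := by
    ext i j
    rw [Matrix.of_apply, ← castMat_mul, trace_castMat]
    rfl
  have hGdet : G.det ≠ 0 := fun h0 => by
    refine det_trace_mul_ne_zero _ hspan hli ?_
    rw [← hGmap, ← RingHom.map_det, h0, map_zero]
  have hGc : (Int.castRingHom ℚ).mapMatrix G *ᵥ c = fun k => (T k : ℚ) := by
    ext k
    simp only [T]
    rw [← trace_castMat, castMat_mul, castMat_mul, ← hc, hGmap]
    simp [Matrix.mulVec, dotProduct, Finset.mul_sum, Matrix.trace_sum, mul_comm]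
  have hHmap : (Int.castRingHom ℚ).mapMatrix H =
      ((Int.castRingHom ℚ).mapMatrix G).updateCol i fun k => (T k : ℚ) := by
    ext k l
    simp only [H, RingHom.mapMatrix_apply, Matrix.map_apply, Matrix.updateCol_apply]
    split_ifs <;> rfl
  have hcramer : (G.det : ℚ) * c i = (H.det : ℚ) := by
    have h1 : (H.det : ℚ) = ((Int.castRingHom ℚ).mapMatrix H).det :=
      RingHom.map_det (Int.castRingHom ℚ) H
    have h2 : (G.det : ℚ) = ((Int.castRingHom ℚ).mapMatrix G).det :=
      RingHom.map_det (Int.castRingHom ℚ) G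
    rw [h1, h2, hHmap, ← Matrix.cramer_apply, ← hGc, Matrix.cramer_eq_adjugate_mulVec,
      Matrix.mulVec_mulVec, Matrix.adjugate_mul, Matrix.smul_mulVec, Matrix.one_mulVec]
    rfl
  have hHdet : |(H.det : ℝ)| ≤ n.factorial * B ^ n := by
    have := Matrix.det_le (A := H) (x := B) (abv := (AbsoluteValue.abs : AbsoluteValue ℝ ℝ).comp
      (f := Int.castRingHom ℝ) Int.cast_injective) fun k l => by
        change |((H k l : ℤ) : ℝ)| ≤ B
        simp only [H, Matrix.updateCol_apply]
        split_ifs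
        · exact hT k j
        · exact hG k l
    rw [Fintype.card_fin, nsmul_eq_mul] at this
    exact this
  have hreal : (G.det : ℝ) * (c i : ℝ) = (H.det : ℝ) := by
    have := congrArg (Rat.cast (K := ℝ)) hcramer
    rwa [Rat.cast_mul, Rat.cast_intCast, Rat.cast_intCast] at this
  have hone : (1 : ℝ) ≤ |(G.det : ℝ)| := by exact_mod_cast Int.one_le_abs hGdet
  calc |(c i : ℝ)| ≤ |(G.det : ℝ)| * |(c i : ℝ)| := le_mul_of_one_le_left (abs_nonneg _) hone
    _ = |(H.det : ℝ)| := by rw [← abs_mul, hreal]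
    _ ≤ _ := hHdet

/-- From a finite spanning family one can choose a basis of positive determinant in which the
whole family has coordinates at most `1` in absolute value. -/
lemma exists_max_det (hd : 2 ≤ d) {ι : Type*} [Finite ι] (u : ι → Fin d → ℚ)
    (hu : Submodule.span ℚ (Set.range u) = ⊤) :
    ∃ f : Fin d → ι, 0 < (Matrix.of fun k l => u (f l) k).det ∧
      ∀ i, ∃ w : Fin d → ℚ, (∀ k, |w k| ≤ 1) ∧ (Matrix.of fun k l => u (f l) k) *ᵥ w = u i := by
  let V : (Fin d → ι) → Matrix (Fin d) (Fin d) ℚ := fun f => Matrix.of fun k l => u (f l) k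
  obtain ⟨f₀, hf₀⟩ : ∃ f₀ : Fin d → ι, (V f₀).det ≠ 0 := by
    have h := exists_fun_fin_of_span_eq_top hu
    rw [Module.finrank_fin_fun] at h
    obtain ⟨v, hv, -, hli⟩ := h
    choose f hf using hv
    refine ⟨f, ?_⟩
    rw [← isUnit_iff_ne_zero, ← Matrix.isUnit_iff_isUnit_det,
      ← Matrix.linearIndependent_cols_iff_isUnit]
    have hcol : (V f).col = v := by
      ext l k
      simp [V, hf]
    rwa [hcol]
  have : Nonempty (Fin d → ι) := ⟨f₀⟩
  obtain ⟨f, hf⟩ := Finite.exists_max fun f => (V f).det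
  have habs : ∀ g, |(V g).det| ≤ (V f).det := by
    intro g
    have hij : (⟨0, by omega⟩ : Fin d) ≠ ⟨1, by omega⟩ := by simp
    have hswap := Matrix.det_permute' (Equiv.swap (⟨0, by omega⟩ : Fin d) ⟨1, by omega⟩) (V g)
    rw [Equiv.Perm.sign_swap hij] at hswap
    have hneg : -(V g).det = (V (g ∘ Equiv.swap (⟨0, by omega⟩ : Fin d) ⟨1, by omega⟩)).det := by
      rw [Units.val_neg, Units.val_one, Int.cast_neg, Int.cast_one, neg_one_mul] at hswap
      exact hswap.symm
    exact abs_le'.2 ⟨hf g, hneg ▸ hf _⟩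
  have hpos : 0 < (V f).det := (abs_pos.2 hf₀).trans_le (habs f₀)
  refine ⟨f, hpos, fun i => ⟨(V f).det⁻¹ • (V f).cramer (u i), fun k => ?_, ?_⟩⟩
  · have hcol : (V f).updateCol k (u i) = V (Function.update f k i) := by
      ext a l
      by_cases hl : l = k <;> simp [V, hl]
    rw [Pi.smul_apply, smul_eq_mul, abs_mul, abs_inv, abs_of_pos hpos, Matrix.cramer_apply, hcol]
    exact inv_mul_le_one_of_le₀ (habs _) hpos.le
  · change V f *ᵥ _ = _
    rw [Matrix.mulVec_smul, Matrix.mulVec_cramer, inv_smul_smul₀ hpos.ne']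

/-- Conjugation by a real matrix of positive determinant can be realised in `SL_d(ℝ)`. -/
lemma exists_specialLinearGroup_conj (hd : 0 < d) {V : Matrix (Fin d) (Fin d) ℝ}
    (hV : 0 < V.det) : ∃ h : Matrix.SpecialLinearGroup (Fin d) ℝ,
      ∀ A X : Matrix (Fin d) (Fin d) ℝ, A * V = V * X →
        (h : Matrix (Fin d) (Fin d) ℝ) * A *
          ((h⁻¹ : Matrix.SpecialLinearGroup (Fin d) ℝ) : Matrix (Fin d) (Fin d) ℝ) = X := by
  let t : ℝ := V.det⁻¹ ^ ((d : ℝ)⁻¹)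
  have ht : t ^ d = V.det⁻¹ := Real.rpow_inv_natCast_pow (inv_pos.2 hV).le hd.ne'
  have hdet : (t • V).det = 1 := by
    rw [Matrix.det_smul, Fintype.card_fin, ht, inv_mul_cancel₀ hV.ne']
  let g : Matrix.SpecialLinearGroup (Fin d) ℝ := ⟨t • V, hdet⟩
  refine ⟨g⁻¹, fun A X hX => ?_⟩
  have hg : A * (g : Matrix (Fin d) (Fin d) ℝ) = g * X := by
    simp only [g, Matrix.mul_smul, Matrix.smul_mul, hX]
  have hinv : ((g⁻¹ : Matrix.SpecialLinearGroup (Fin d) ℝ) : Matrix (Fin d) (Fin d) ℝ) *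
      (g : Matrix (Fin d) (Fin d) ℝ) = 1 := by
    rw [← Matrix.SpecialLinearGroup.coe_mul, inv_mul_cancel, Matrix.SpecialLinearGroup.coe_one]
  rw [inv_inv, mul_assoc, hg, ← mul_assoc, hinv, one_mul]

end LinearAlgebra

section ConjugationBound

open scoped Matrix

variable {d : ℕ}

/-- A uniform power of a generating set of a Zariski dense subgroup spans the matrix algebra and
contains an element of spectral radius at least `2`. -/
lemma exists_pow_span_eq_top_and_two_le_LamZ (hd : 2 ≤ d) :
    ∃ N : ℕ, ∀ S : Set (Matrix.SpecialLinearGroup (Fin d) ℤ), 1 ∈ S →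
      ZariskiDenseSLZ d (Subgroup.closure S) →
      Submodule.span ℚ (Set.image (castMat ℚ) (S ^ N)) = ⊤ ∧ ∃ a ∈ S ^ N, 2 ≤ LamZ a := by
  let s : Finset ℤ := Finset.Icc (-(2 * d)) (2 * d)
  have hs : ∀ n ∈ s, n ≤ 2 * d := fun n hn => (Finset.mem_Icc.1 hn).2
  obtain ⟨N, hN⟩ := exists_pow_escape d s.card
  refine ⟨N, fun S h1 hS => ⟨?_, ?_⟩⟩
  · by_contra hspan
    obtain ⟨φ, hφ0, hφ⟩ := Submodule.exists_le_ker_of_lt_top _ (lt_top_iff_ne_top.2 hspan)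
    refine hφ0 (linearMap_eq_zero_of_zariskiDense hd hS φ (hN S h1 _ ?_ fun a ha =>
      hφ (Submodule.subset_span ⟨a, ha, rfl⟩)))
    have hcard : s.card ≠ 0 :=
      Finset.card_ne_zero_of_mem (Finset.mem_Icc.2 ⟨by omega, by omega⟩ : (0 : ℤ) ∈ s)
    exact le_self_pow one_le_affineFunctions hcard (linearMap_castMat_mem_affineFunctions φ)
  · have hprod : ∀ t : Finset ℤ, (fun γ : Matrix.SpecialLinearGroup (Fin d) ℤ =>
        ∏ n ∈ t, ((castMat ℚ γ).trace - n)) ∈ affineFunctions d ^ t.card := by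
      intro t
      induction t using Finset.induction_on with
      | empty =>
        simp only [Finset.prod_empty, Finset.card_empty, pow_zero]
        exact Submodule.one_le.1 le_rfl
      | insert n t hn ih =>
        rw [Finset.card_insert_of_notMem hn, pow_succ']
        simp_rw [Finset.prod_insert hn]
        exact Submodule.mul_mem_mul (sub_mem
          (linearMap_castMat_mem_affineFunctions (Matrix.traceLinearMap (Fin d) ℚ ℚ))
          (const_mem_affineFunctions _)) ih
    obtain ⟨γ, hγ, hne⟩ := exists_trace_of_zariskiDense hd hS s hs
    obtain ⟨a, ha, hane⟩ : ∃ a ∈ S ^ N, ∏ n ∈ s, ((castMat ℚ a).trace - n) ≠ 0 := by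
      by_contra! h
      exact hne (hN S h1 _ (hprod s) h γ hγ)
    refine ⟨a, ha, ?_⟩
    have hmem : (a : Matrix (Fin d) (Fin d) ℤ).trace ∉ s := fun hmem =>
      hane (Finset.prod_eq_zero hmem (by rw [trace_castMat, sub_self]))
    have hlt : 2 * (d : ℤ) < |(a : Matrix (Fin d) (Fin d) ℤ).trace| := by
      by_contra! h
      exact hmem (Finset.mem_Icc.2 (abs_le.1 h))
    have hlt' : 2 * (d : ℝ) < |((a : Matrix (Fin d) (Fin d) ℤ).trace : ℝ)| := by
      exact_mod_cast hlt
    have hdpos : (0 : ℝ) < d := by positivity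
    have := hlt'.le.trans (abs_trace_le_LamZ a)
    nlinarith

/-- If a power of `S` spans the matrix algebra, then `S` can be conjugated to have norm bounded by
a power of the spectral radii of a larger power of `S`. -/
lemma exists_conj_opNormR_le (hd : 2 ≤ d) {N : ℕ}
    {S : Set (Matrix.SpecialLinearGroup (Fin d) ℤ)} (h1 : 1 ∈ S)
    (hspan : Submodule.span ℚ (Set.image (castMat ℚ) (S ^ N)) = ⊤) {L : ℝ}
    (hL : ∀ a ∈ S ^ (2 * N + 1), LamZ a ≤ L) :
    ∃ h : Matrix.SpecialLinearGroup (Fin d) ℝ, ∀ σ ∈ S,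
      opNormR ((h : Matrix (Fin d) (Fin d) ℝ) * intMat σ *
        ((h⁻¹ : Matrix.SpecialLinearGroup (Fin d) ℝ) : Matrix (Fin d) (Fin d) ℝ)) ≤
      d * (d * ((d * d : ℕ) * ((d * d).factorial * (d * L) ^ (d * d)))) := by
  have hmat := exists_fun_fin_of_span_eq_top hspan
  rw [Module.finrank_matrix, Fintype.card_fin, Module.finrank_self, mul_one] at hmat
  generalize hn : d * d = n at hmat ⊢
  obtain ⟨v, hv, hvspan, hli⟩ := hmat
  choose b hb hbv using hv
  obtain rfl : (fun i => castMat ℚ (b i)) = v := funext hbv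
  have htr : ∀ a ∈ S ^ (2 * N + 1), |(a.1.trace : ℝ)| ≤ d * L := fun a ha =>
    (abs_trace_le_LamZ a).trans (by gcongr; exact hL a ha)
  have hG : ∀ i j, |((b i * b j).1.trace : ℝ)| ≤ d * L := fun i j => by
    refine htr _ (Set.pow_subset_pow_right h1 (by omega : N + N ≤ 2 * N + 1) ?_)
    rw [pow_add]
    exact Set.mul_mem_mul (hb i) (hb j)
  have hT : ∀ σ ∈ S, ∀ i j, |((b i * (σ * b j)).1.trace : ℝ)| ≤ d * L := fun σ hσ i j => by
    refine htr _ ?_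
    rw [show 2 * N + 1 = N + (N + 1) by omega, pow_add, pow_succ']
    exact Set.mul_mem_mul (hb i) (Set.mul_mem_mul hσ (hb j))
  let e : Fin d := ⟨0, by omega⟩
  let π : Matrix (Fin d) (Fin d) ℚ →ₗ[ℚ] (Fin d → ℚ) :=
    { toFun := fun x => x.col e, map_add' := fun _ _ => rfl, map_smul' := fun _ _ => rfl }
  have hπ : Submodule.span ℚ (Set.range fun i => π (castMat ℚ (b i))) = ⊤ := by
    have hsurj : Function.Surjective π := fun v => ⟨Matrix.of fun k _ => v k, rfl⟩
    rw [Set.range_comp' π, ← Submodule.map_span, hvspan, Submodule.map_top,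
      LinearMap.range_eq_top.2 hsurj]
  obtain ⟨f, hdet, hw⟩ := exists_max_det hd _ hπ
  choose w hw1 hw using hw
  set V : Matrix (Fin d) (Fin d) ℚ := Matrix.of fun k l => π (castMat ℚ (b (f l))) k with hV
  have hdetR : 0 < ((Rat.castHom ℝ).mapMatrix V).det := by
    rw [← RingHom.map_det]
    exact Rat.cast_pos.2 hdet
  obtain ⟨h, hh⟩ := exists_specialLinearGroup_conj (by omega) hdetR
  refine ⟨h, fun σ hσ => ?_⟩
  choose c hc hcB using exists_coeff_bound b hvspan hli σ hG (hT σ hσ)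
  let X : Matrix (Fin d) (Fin d) ℚ := Matrix.of fun k l => ∑ i, c (f l) i * w i k
  have hX : castMat ℚ σ * V = V * X := by
    ext k l
    have h2 : castMat ℚ σ *ᵥ π (castMat ℚ (b (f l))) = V *ᵥ fun k => X k l := by
      have h3 : (fun k => X k l) = ∑ i, c (f l) i • w i := by
        ext k
        simp [X]
      calc castMat ℚ σ *ᵥ π (castMat ℚ (b (f l)))
          = π (castMat ℚ σ * castMat ℚ (b (f l))) := rfl
        _ = ∑ i, c (f l) i • π (castMat ℚ (b i)) := by rw [hc, map_sum]; simp
        _ = V *ᵥ fun k => X k l := by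
          rw [h3, Matrix.mulVec_sum]
          simp_rw [Matrix.mulVec_smul, hw]
    exact congrFun h2 k
  have hXR : intMat σ * (Rat.castHom ℝ).mapMatrix V =
      (Rat.castHom ℝ).mapMatrix V * (Rat.castHom ℝ).mapMatrix X := by
    have hσR : intMat σ = (Rat.castHom ℝ).mapMatrix (castMat ℚ σ) := by
      ext i j
      simp [intMat]
    rw [hσR, ← map_mul, hX, map_mul]
  rw [hh _ _ hXR]
  refine (opNormR_le_sum _).trans ?_
  have hentry : ∀ k l, |(Rat.castHom ℝ).mapMatrix X k l| ≤
      n * (n.factorial * (d * L) ^ n) := by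
    intro k l
    have : (Rat.castHom ℝ).mapMatrix X k l = ∑ i, (c (f l) i : ℝ) * (w i k : ℝ) := by
      simp [X]
    rw [this]
    refine (Finset.abs_sum_le_sum_abs _ _).trans ((Finset.sum_le_card_nsmul _ _
      (n.factorial * (d * L) ^ n) fun i _ => ?_).trans_eq (by simp))
    rw [abs_mul]
    have hw' : |(w i k : ℝ)| ≤ 1 := by exact_mod_cast hw1 i k
    exact (mul_le_of_le_one_right (abs_nonneg _) hw').trans (hcB _ _)
  refine (Finset.sum_le_card_nsmul _ _ _ fun k _ =>
    Finset.sum_le_card_nsmul _ _ _ fun l _ => hentry k l).trans_eq (by simp)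

end ConjugationBound

theorem stmt14 {d : ℕ} (hd : 2 ≤ d) :
    ∃ r' : ℕ, ∀ S : Finset (Matrix.SpecialLinearGroup (Fin d) ℤ),
      (1 : Matrix.SpecialLinearGroup (Fin d) ℤ) ∈ S →
      ZariskiDenseSLZ d (Subgroup.closure (S : Set (Matrix.SpecialLinearGroup (Fin d) ℤ))) →
      ∃ h : Matrix.SpecialLinearGroup (Fin d) ℝ,
        ∀ σ ∈ S, ∃ a ∈ (S : Set (Matrix.SpecialLinearGroup (Fin d) ℤ)) ^ r',
          opNormR ((h : Matrix (Fin d) (Fin d) ℝ) * intMat σ *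
              ((h⁻¹ : Matrix.SpecialLinearGroup (Fin d) ℝ) : Matrix (Fin d) (Fin d) ℝ)) ≤
            LamZ a := by
  obtain ⟨N, hN⟩ := exists_pow_span_eq_top_and_two_le_LamZ hd
  let C : ℝ := d * (d * ((d * d : ℕ) * ((d * d).factorial * d ^ (d * d))))
  obtain ⟨m, hm⟩ := pow_unbounded_of_one_lt C one_lt_two
  refine ⟨(2 * N + 1) * (m + d * d), fun S h1 hS => ?_⟩
  have h1' : (1 : Matrix.SpecialLinearGroup (Fin d) ℤ) ∈
      (S : Set (Matrix.SpecialLinearGroup (Fin d) ℤ)) := h1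
  obtain ⟨hspan, a₀, ha₀, htwo⟩ := hN S h1' hS
  have hfin : ((S : Set (Matrix.SpecialLinearGroup (Fin d) ℤ)) ^ (2 * N + 1)).Finite := by
    classical
    rw [← Finset.coe_pow]
    exact Finset.finite_toSet _
  obtain ⟨a, ha, hmax⟩ := Set.exists_max_image _ LamZ hfin ⟨1, Set.one_mem_pow h1'⟩
  obtain ⟨h, hh⟩ := exists_conj_opNormR_le hd h1' hspan hmax
  have ha2 : 2 ≤ LamZ a :=
    htwo.trans (hmax a₀ (Set.pow_subset_pow_right h1' (by omega) ha₀))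
  refine ⟨h, fun σ hσ => ⟨a ^ (m + d * d), ?_, ?_⟩⟩
  · rw [pow_mul]
    exact Set.pow_mem_pow ha
  · calc _ ≤ _ := hh σ hσ
      _ = C * LamZ a ^ (d * d) := by
        rw [mul_pow]
        ring
      _ ≤ LamZ a ^ m * LamZ a ^ (d * d) := by
        gcongr
        exact hm.le.trans (by gcongr)
      _ = LamZ a ^ (m + d * d) := (pow_add _ _ _).symm
      _ ≤ LamZ (a ^ (m + d * d)) := LamZ_pow_le (by omega) a _
end
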